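/- Let X be an Archimedean uniformly complete lattice-ordered algebra. Then: (i) for every n ∈ ℕ and every x₁, …, xₙ ∈ X there exists a lattice-algebra homomorphism Ψ : PG_n^h → X with Ψ(πᵢ) = xᵢ for i = 1, …, n, if and only if X is an f-algebra; and (ii) if X has a multiplicative identity 1_X, then for every n ∈ ℕ and every x₁, …, xₙ ∈ X there exists a lattice-algebra homomorphism Ψ : PG_n → X with Ψ(𝟙) = 1_X and Ψ(πᵢ) = xᵢ for i = 1, …, n, if and only if X is an f-algebra. -/

import Mathlib

open scoped BigOperators

/-- A continuous function `ℝⁿ → ℝ` of polynomial growth (an element of `PG_n`). -/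
def PolyGrowth (n : ℕ) (f : (Fin n → ℝ) → ℝ) : Prop :=
  Continuous f ∧ ∃ (M : ℝ) (N : ℕ), 0 ≤ M ∧
    ∀ t : Fin n → ℝ, |f t| ≤ M * (1 + ∑ i : Fin n, |t i|) ^ N

/-- An element of `PG_n^h`: a polynomial growth continuous function `f` such that
`f (t • x) / t` converges as `t → 0⁺`, uniformly in `x` on every bounded set. -/
def PolyGrowthH (n : ℕ) (f : (Fin n → ℝ) → ℝ) : Prop :=
  PolyGrowth n f ∧ ∃ fh : (Fin n → ℝ) → ℝ,
    ∀ B : Set (Fin n → ℝ), Bornology.IsBounded B →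
      ∀ ε : ℝ, 0 < ε → ∃ δ : ℝ, 0 < δ ∧
        ∀ t : ℝ, 0 < t → t < δ → ∀ y ∈ B, |f (t • y) / t - fh y| < ε

/-- An element of `H_n`: a continuous positively homogeneous function `ℝⁿ → ℝ`. -/
def PosHomog (n : ℕ) (f : (Fin n → ℝ) → ℝ) : Prop :=
  Continuous f ∧ ∀ (c : ℝ), 0 ≤ c → ∀ t : Fin n → ℝ, f (c • t) = c * f t

section Defs

variable {X : Type*} [Lattice X] [AddCommGroup X] [Module ℝ X]

/-- The order ideal `I_e` generated by `e`. -/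
def idealSet (e : X) : Set X := {x : X | ∃ c : ℝ, 0 ≤ c ∧ |x| ≤ c • e}

/-- The norm `‖x‖_e = inf {c ≥ 0 : |x| ≤ c • e}`. -/
noncomputable def regNorm (e x : X) : ℝ := sInf {c : ℝ | 0 ≤ c ∧ |x| ≤ c • e}

/-- The norm `‖·‖_e` is complete on the set `S`: every `‖·‖_e`-Cauchy sequence in `S`
converges, in `‖·‖_e`, to an element of `S`. -/
def NormComplete (e : X) (S : Set X) : Prop :=
  ∀ u : ℕ → X, (∀ k, u k ∈ S) →
    (∀ ε : ℝ, 0 < ε → ∃ N : ℕ, ∀ p q : ℕ, N ≤ p → N ≤ q → regNorm e (u p - u q) < ε) →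
    ∃ x ∈ S, ∀ ε : ℝ, 0 < ε → ∃ N : ℕ, ∀ p : ℕ, N ≤ p → regNorm e (u p - x) < ε

/-- A uniformly complete vector lattice: `(I_e, ‖·‖_e)` is complete for every `e ≥ 0`. -/
def UniformlyComplete (X : Type*) [Lattice X] [AddCommGroup X] [Module ℝ X] : Prop :=
  ∀ e : X, 0 ≤ e → NormComplete e (idealSet e)

/-- A subset `Z` is uniformly complete as a vector lattice in its own right. -/
def UCSet (Z : Set X) : Prop :=
  ∀ e ∈ Z, 0 ≤ e → NormComplete e (Z ∩ idealSet e)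

/-- A (vector) sublattice: a linear subspace closed under binary suprema. -/
def IsSublatticeSet (Z : Set X) : Prop :=
  (0 ∈ Z) ∧ (∀ a ∈ Z, ∀ b ∈ Z, a + b ∈ Z) ∧ (∀ (c : ℝ), ∀ a ∈ Z, c • a ∈ Z) ∧
  (∀ a ∈ Z, -a ∈ Z) ∧ (∀ a ∈ Z, ∀ b ∈ Z, a ⊔ b ∈ Z) ∧ (∀ a ∈ Z, ∀ b ∈ Z, a ⊓ b ∈ Z)

/-- An order ideal: a linear subspace that is solid. -/
def IsOrderIdealSet (I : Set X) : Prop :=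
  (0 ∈ I) ∧ (∀ a ∈ I, ∀ b ∈ I, a + b ∈ I) ∧ (∀ (c : ℝ), ∀ a ∈ I, c • a ∈ I) ∧
  (∀ a ∈ I, ∀ b : X, |b| ≤ |a| → b ∈ I)

/-- A vector lattice homomorphism defined on the class of functions `ℝⁿ → ℝ`
satisfying the predicate `P` (with pointwise operations), taking values in `X`. -/
def IsLatHom {n : ℕ} (P : ((Fin n → ℝ) → ℝ) → Prop) (Φ : ∀ f, P f → X) : Prop :=
  (∀ (f g : (Fin n → ℝ) → ℝ) (hf : P f) (hg : P g) (hfg : P (f + g)),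
      Φ (f + g) hfg = Φ f hf + Φ g hg) ∧
  (∀ (c : ℝ) (f : (Fin n → ℝ) → ℝ) (hf : P f) (hcf : P (c • f)),
      Φ (c • f) hcf = c • Φ f hf) ∧
  (∀ (f g : (Fin n → ℝ) → ℝ) (hf : P f) (hg : P g) (hfg : P (f ⊔ g)),
      Φ (f ⊔ g) hfg = Φ f hf ⊔ Φ g hg)

end Defs

section MulDefs

variable {X : Type*} [Lattice X] [AddCommGroup X] [Module ℝ X] [Mul X]

/-- A lattice-algebra homomorphism defined on the class of functions `ℝⁿ → ℝ`
satisfying the predicate `P` (with pointwise operations), taking values in `X`. -/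
def IsLatAlgHom {n : ℕ} (P : ((Fin n → ℝ) → ℝ) → Prop) (Ψ : ∀ f, P f → X) : Prop :=
  IsLatHom P Ψ ∧
  (∀ (f g : (Fin n → ℝ) → ℝ) (hf : P f) (hg : P g) (hfg : P (f * g)),
      Ψ (f * g) hfg = Ψ f hf * Ψ g hg)

/-- A sublattice-algebra: a linear subspace that is both a sublattice and a subalgebra. -/
def IsSublatticeAlgebraSet (Z : Set X) : Prop :=
  IsSublatticeSet Z ∧ ∀ a ∈ Z, ∀ b ∈ Z, a * b ∈ Z

/-- The `f`-algebra condition, relativized to a subset. -/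
def IsFAlgebraSet (Z : Set X) : Prop :=
  ∀ a ∈ Z, ∀ b ∈ Z, ∀ z ∈ Z, a ⊓ b = 0 → 0 ≤ z → (z * a) ⊓ b = 0 ∧ (a * z) ⊓ b = 0

/-- An `f`-subalgebra: a sublattice-algebra which is itself an `f`-algebra. -/
def IsFSubalgebra (Z : Set X) : Prop := IsSublatticeAlgebraSet Z ∧ IsFAlgebraSet Z

/-- `powS e m = e^(m+1)`, defined without assuming an identity element. -/
def powS (e : X) : ℕ → X
  | 0 => e
  | m + 1 => powS e m * e

end MulDefs

/-- A map `T : X → A` which is a lattice-algebra homomorphism on a subset `S` of `X`. -/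
def IsLatAlgHomOn {X A : Type*} [Lattice X] [AddCommGroup X] [Module ℝ X] [Mul X]
    [Lattice A] [AddCommGroup A] [Module ℝ A] [Mul A] (S : Set X) (T : X → A) : Prop :=
  (∀ a ∈ S, ∀ b ∈ S, T (a + b) = T a + T b) ∧
  (∀ (c : ℝ), ∀ a ∈ S, T (c • a) = c • T a) ∧
  (∀ a ∈ S, ∀ b ∈ S, T (a ⊔ b) = T a ⊔ T b) ∧
  (∀ a ∈ S, ∀ b ∈ S, T (a * b) = T a * T b)

universe u

section VectorLattice

variable {X : Type*} [Lattice X] [AddCommGroup X] [IsOrderedAddMonoid X]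

theorem add_inf_le_inf_add_inf {a b c : X} (ha : 0 ≤ a) (hb : 0 ≤ b) (hc : 0 ≤ c) :
    (a + b) ⊓ c ≤ a ⊓ c + b ⊓ c := by
  rw [add_inf, inf_add, inf_add]
  refine le_inf (le_inf inf_le_left (inf_le_right.trans ?_))
    (le_inf (inf_le_right.trans ?_) (inf_le_right.trans ?_))
  · simpa using hb
  · simpa using ha
  · simpa using hc

theorem inf_eq_zero_of_le {a b c : X} (hc : 0 ≤ c) (hb : 0 ≤ b) (h : a ⊓ b = 0) (hca : c ≤ a) :
    c ⊓ b = 0 :=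
  le_antisymm (h ▸ inf_le_inf_right b hca) (le_inf hc hb)

theorem add_inf_eq_zero {a b c : X} (ha : a ⊓ c = 0) (hb : b ⊓ c = 0) : (a + b) ⊓ c = 0 := by
  have h0a : 0 ≤ a := ha ▸ inf_le_left
  have h0c : 0 ≤ c := ha ▸ inf_le_right
  have h0b : 0 ≤ b := hb ▸ inf_le_left
  refine le_antisymm ?_ (le_inf (add_nonneg h0a h0b) h0c)
  simpa [ha, hb] using add_inf_le_inf_add_inf h0a h0b h0c

theorem nsmul_inf_eq_zero {a b : X} (h : a ⊓ b = 0) (n : ℕ) : (n • a) ⊓ b = 0 := by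
  induction n with
  | zero => simpa using (h ▸ inf_le_right : 0 ≤ b)
  | succ n ih => rw [succ_nsmul]; exact add_inf_eq_zero ih h

theorem nsmul_inf_nsmul_eq_zero {a b : X} (h : a ⊓ b = 0) (m n : ℕ) : (m • a) ⊓ (n • b) = 0 := by
  rw [inf_comm]
  refine nsmul_inf_eq_zero ?_ n
  rw [inf_comm]
  exact nsmul_inf_eq_zero h m

theorem posPart_inf_posPart_neg (a : X) : a⁺ ⊓ (-a)⁺ = 0 := by
  rw [posPart_neg]
  exact posPart_inf_negPart_eq_zero a

theorem posPart_add_le (a b : X) : (a + b)⁺ ≤ a⁺ + b⁺ :=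
  sup_le (add_le_add (le_posPart a) (le_posPart b))
    (add_nonneg (posPart_nonneg a) (posPart_nonneg b))

/-- A set of positive elements which is the positive cone of a prime order ideal. -/
structure IsPrimeCone (P : Set X) : Prop where
  zero_mem : 0 ∈ P
  add_mem : ∀ a ∈ P, ∀ b ∈ P, a + b ∈ P
  mem_of_le : ∀ a b, 0 ≤ a → a ≤ b → b ∈ P → a ∈ P
  prime : ∀ a b, a ⊓ b = 0 → a ∈ P ∨ b ∈ P

theorem IsPrimeCone.nsmul_mem {P : Set X} (hP : IsPrimeCone P) {a : X} (ha : a ∈ P) (n : ℕ) :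
    n • a ∈ P := by
  induction n with
  | zero => simpa using hP.zero_mem
  | succ n ih => rw [succ_nsmul]; exact hP.add_mem _ ih _ ha

theorem exists_isPrimeCone_notMem {u : X} (hu : 0 ≤ u) (hu0 : u ≠ 0) :
    ∃ P : Set X, IsPrimeCone P ∧ u ∉ P := by
  let S : Set (Set X) := {P | (∀ a ∈ P, 0 ≤ a) ∧ 0 ∈ P ∧ (∀ a ∈ P, ∀ b ∈ P, a + b ∈ P) ∧
    (∀ a b, 0 ≤ a → a ≤ b → b ∈ P → a ∈ P) ∧ u ∉ P}
  obtain ⟨P, -, hP⟩ := zorn_subset_nonempty S (by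
    intro c hcS hc ⟨P₀, hP₀⟩
    refine ⟨⋃₀ c, ⟨?_, ?_, ?_, ?_, ?_⟩, fun s hs => Set.subset_sUnion_of_mem hs⟩
    · rintro a ⟨P, hPc, haP⟩
      exact (hcS hPc).1 a haP
    · exact ⟨P₀, hP₀, (hcS hP₀).2.1⟩
    · rintro a ⟨P, hPc, haP⟩ b ⟨Q, hQc, hbQ⟩
      rcases hc.total hPc hQc with h | h
      · exact ⟨Q, hQc, (hcS hQc).2.2.1 a (h haP) b hbQ⟩
      · exact ⟨P, hPc, (hcS hPc).2.2.1 a haP b (h hbQ)⟩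
    · rintro a b ha hab ⟨P, hPc, hbP⟩
      exact ⟨P, hPc, (hcS hPc).2.2.2.1 a b ha hab hbP⟩
    · rintro ⟨P, hPc, huP⟩
      exact (hcS hPc).2.2.2.2 huP) {0} (by
    refine ⟨by simp, by simp, by simp, ?_, by simpa using hu0⟩
    rintro a b ha hab rfl
    exact le_antisymm hab ha)
  obtain ⟨⟨hnn, h0, hadd, hle, huP⟩, hmax⟩ := hP
  have key : ∀ a, 0 ≤ a → a ∉ P → ∃ p ∈ P, ∃ k : ℕ, u ≤ p + k • a := by
    intro a ha haP
    by_contra! hcon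
    let Q : Set X := {x | 0 ≤ x ∧ ∃ p ∈ P, ∃ k : ℕ, x ≤ p + k • a}
    have hQ : Q ∈ S := by
      refine ⟨fun x hx => hx.1, ⟨le_rfl, 0, h0, 0, by simp⟩, ?_, ?_, ?_⟩
      · rintro x ⟨hx, p, hp, k, hk⟩ y ⟨hy, q, hq, l, hl⟩
        refine ⟨add_nonneg hx hy, p + q, hadd p hp q hq, k + l, (add_le_add hk hl).trans_eq ?_⟩
        rw [add_nsmul]
        abel
      · rintro x y hx hxy ⟨-, p, hp, k, hk⟩
        exact ⟨hx, p, hp, k, hxy.trans hk⟩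
      · rintro ⟨-, p, hp, k, hk⟩
        exact hcon p hp k hk
    have hPQ : P ≤ Q := fun x hx => ⟨hnn x hx, x, hx, 0, by simp⟩
    exact haP (hmax hQ hPQ ⟨ha, 0, h0, 1, by simp⟩)
  refine ⟨P, ⟨h0, hadd, hle, ?_⟩, huP⟩
  intro a b hab
  by_contra! hcon
  obtain ⟨p, hp, k, hk⟩ := key a (hab ▸ inf_le_left) hcon.1
  obtain ⟨q, hq, l, hl⟩ := key b (hab ▸ inf_le_right) hcon.2
  refine huP (hle u (p + q) hu ?_ (hadd p hp q hq))
  have h1 : u ≤ (p + q) + k • a := hk.trans (by simpa using hnn q hq)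
  have h2 : u ≤ (p + q) + l • b := hl.trans (by simpa using hnn p hp)
  simpa [← add_inf, nsmul_inf_nsmul_eq_zero hab] using le_inf h1 h2

end VectorLattice

section Archimedean

variable {X : Type*} [Lattice X] [AddCommGroup X] [Module ℝ X] [IsOrderedAddMonoid X]
  [PosSMulMono ℝ X]

theorem nonpos_of_forall_le_smul
    (hA : ∀ a b : X, 0 ≤ a → 0 ≤ b → (∀ k : ℕ, k • a ≤ b) → a = 0) {a e : X} (he : 0 ≤ e)
    (h : ∀ ε : ℝ, 0 < ε → a ≤ ε • e) : a ≤ 0 := by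
  rw [← posPart_eq_zero]
  refine hA a⁺ e (posPart_nonneg a) he fun k => ?_
  have hk : (0 : ℝ) < (k : ℝ) + 1 := by positivity
  have h1 : a⁺ ≤ ((k : ℝ) + 1)⁻¹ • e :=
    sup_le (h _ (inv_pos.mpr hk)) (smul_nonneg (inv_pos.mpr hk).le he)
  have h2 := smul_le_smul_of_nonneg_left h1 hk.le
  rw [smul_inv_smul₀ hk.ne', add_smul, one_smul, Nat.cast_smul_eq_nsmul] at h2
  exact (le_add_of_nonneg_right (posPart_nonneg a)).trans h2

theorem eq_zero_of_forall_abs_le_smul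
    (hA : ∀ a b : X, 0 ≤ a → 0 ≤ b → (∀ k : ℕ, k • a ≤ b) → a = 0) {a e : X} (he : 0 ≤ e)
    (h : ∀ ε : ℝ, 0 < ε → |a| ≤ ε • e) : a = 0 :=
  le_antisymm (nonpos_of_forall_le_smul hA he fun ε hε => (le_abs_self a).trans (h ε hε))
    (neg_nonpos.mp (nonpos_of_forall_le_smul hA he fun ε hε => (neg_le_abs a).trans (h ε hε)))

theorem posPart_smul_le {c : ℝ} (hc : 0 ≤ c) (a : X) : (c • a)⁺ ≤ c • a⁺ :=
  sup_le (smul_le_smul_of_nonneg_left (le_posPart a) hc) (smul_nonneg hc (posPart_nonneg a))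

end Archimedean

section Place

variable {X : Type*} [Lattice X] [NonUnitalRing X] [Module ℝ X]

/-- The cone `C` of "nonpositive" elements of a total quotient of the vector lattice `X` in which
`e` is positive, multiplication by positive elements respects `C` up to infinitesimal multiples
of `e`, and `e * e` is bounded by a multiple of `e`. -/
structure IsPlace (e : X) (C : X → Prop) : Prop where
  of_nonpos : ∀ a, a ≤ 0 → C a
  add : ∀ a b, C a → C b → C (a + b)
  smul : ∀ (c : ℝ) (a : X), 0 ≤ c → C a → C (c • a)
  sup : ∀ a b, C a → C b → C (a ⊔ b)
  total : ∀ a, C a ∨ C (-a)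
  notMem : ¬ C e
  mul_left : ∀ (a c : X) (ε : ℝ), C a → 0 < ε → 0 ≤ c → C (c * (a - ε • e))
  mul_right : ∀ (a c : X) (ε : ℝ), C a → 0 < ε → 0 ≤ c → C ((a - ε • e) * c)
  exists_sq_le : ∃ K : ℝ, C (e * e - K • e)

variable [IsOrderedAddMonoid X] [PosSMulMono ℝ X] [PosMulMono X] [MulPosMono X]

theorem IsPrimeCone.isPlace
    (hF : ∀ a b z : X, a ⊓ b = 0 → 0 ≤ z → (z * a) ⊓ b = 0 ∧ (a * z) ⊓ b = 0)
    {P : Set X} (hP : IsPrimeCone P) {e : X} (he : 0 ≤ e) (heP : e ∉ P) {K : ℝ}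
    (hK : (e * e - K • e)⁺ ∈ P) : IsPlace e (fun a => a⁺ ∈ P) := by
  have hsmul : ∀ (c : ℝ) (a : X), 0 ≤ c → a⁺ ∈ P → (c • a)⁺ ∈ P := by
    intro c a hc ha
    obtain ⟨n, hn⟩ := exists_nat_ge c
    refine hP.mem_of_le _ _ (posPart_nonneg _) ((posPart_smul_le hc a).trans ?_)
      (hP.nsmul_mem ha n)
    have h := smul_nonneg (sub_nonneg.mpr hn) (posPart_nonneg a)
    rwa [sub_smul, sub_nonneg, Nat.cast_smul_eq_nsmul] at h
  have hpos : ∀ (a : X) (ε : ℝ), a⁺ ∈ P → 0 < ε → (-(a - ε • e))⁺ ∉ P := by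
    intro a ε ha hε h
    have h1 : ε • e ≤ a⁺ + (-(a - ε • e))⁺ := by
      calc ε • e = a + -(a - ε • e) := by abel
        _ ≤ _ := add_le_add (le_posPart _) (le_posPart _)
    have h2 : (ε • e)⁺ ∈ P := by
      rw [posPart_of_nonneg (smul_nonneg hε.le he)]
      exact hP.mem_of_le _ _ (smul_nonneg hε.le he) h1 (hP.add_mem _ ha _ h)
    have h3 := hsmul ε⁻¹ _ (inv_pos.mpr hε).le h2
    rw [inv_smul_smul₀ hε.ne', posPart_of_nonneg he] at h3
    exact heP h3
  refine ⟨?_, ?_, hsmul, ?_, ?_, ?_, ?_, ?_, K, hK⟩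
  · intro a ha
    rw [posPart_eq_zero.mpr ha]
    exact hP.zero_mem
  · intro a b ha hb
    exact hP.mem_of_le _ _ (posPart_nonneg _) (posPart_add_le a b) (hP.add_mem _ ha _ hb)
  · intro a b ha hb
    refine hP.mem_of_le _ _ (posPart_nonneg _) ?_ (hP.add_mem _ ha _ hb)
    refine sup_le (sup_le ?_ ?_) (add_nonneg (posPart_nonneg a) (posPart_nonneg b))
    · exact (le_posPart a).trans (le_add_of_nonneg_right (posPart_nonneg b))
    · exact (le_posPart b).trans (le_add_of_nonneg_left (posPart_nonneg a))
  · intro a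
    exact hP.prime _ _ (posPart_inf_posPart_neg a)
  · rwa [posPart_of_nonneg he]
  · intro a c ε ha hε hc
    have h := (hP.prime _ _ (hF _ _ c (posPart_inf_posPart_neg (a - ε • e)) hc).1).resolve_right
      (hpos a ε ha hε)
    refine hP.mem_of_le _ _ (posPart_nonneg _) (sup_le ?_ ?_) h
    · exact mul_le_mul_of_nonneg_left (le_posPart _) hc
    · exact mul_nonneg hc (posPart_nonneg _)
  · intro a c ε ha hε hc
    have h := (hP.prime _ _ (hF _ _ c (posPart_inf_posPart_neg (a - ε • e)) hc).2).resolve_right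
      (hpos a ε ha hε)
    refine hP.mem_of_le _ _ (posPart_nonneg _) (sup_le ?_ ?_) h
    · exact mul_le_mul_of_nonneg_right (le_posPart _) hc
    · exact mul_nonneg (posPart_nonneg _) hc

theorem exists_isPlace_not
    (hA : ∀ a b : X, 0 ≤ a → 0 ≤ b → (∀ k : ℕ, k • a ≤ b) → a = 0)
    (hF : ∀ a b z : X, a ⊓ b = 0 → 0 ≤ z → (z * a) ⊓ b = 0 ∧ (a * z) ⊓ b = 0)
    {e y : X} (he : 0 ≤ e) (hy : 0 ≤ y) (hy0 : y ≠ 0) (hye : ∀ b, b ⊓ e = 0 → y ⊓ b = 0) :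
    ∃ C : X → Prop, IsPlace e C ∧ ∃ ε : ℝ, 0 < ε ∧ ¬ C (y - ε • e) := by
  obtain ⟨ε, hε, hyε⟩ : ∃ ε : ℝ, 0 < ε ∧ ¬ y ≤ ε • e := by
    by_contra! h
    exact hy0 (le_antisymm (nonpos_of_forall_le_smul hA he h) hy)
  set b : X := (y - ε • e)⁺ with hb
  have hbnn : 0 ≤ b := posPart_nonneg _
  have hb0 : b ≠ 0 := by
    rw [hb, Ne, posPart_eq_zero, sub_nonpos]
    exact hyε
  have hby : b ≤ y := sup_le (sub_le_self y (smul_nonneg hε.le he)) hy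
  have hbe : b ⊓ e ≠ 0 := by
    intro h
    have := hye b h
    rw [inf_eq_right.mpr hby] at this
    exact hb0 this
  have hee : 0 ≤ e * e := mul_nonneg he he
  obtain ⟨k, hk⟩ : ∃ k : ℕ, b ⊓ (k • e - e * e)⁺ ≠ 0 := by
    by_contra! h
    refine hbe (hA _ _ (le_inf hbnn he) hee fun k => ?_)
    have h1 : k • b ⊓ (k • e - e * e)⁺ = 0 := nsmul_inf_eq_zero (h k) k
    have h2 : k • e ≤ (k • e - e * e)⁺ + e * e := by
      simpa [sub_le_iff_le_add] using le_posPart (k • e - e * e)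
    have h3 : 0 ≤ k • b := nsmul_nonneg hbnn k
    calc k • (b ⊓ e) ≤ ((k • e - e * e)⁺ + e * e) ⊓ k • b :=
          le_inf ((nsmul_le_nsmul_right inf_le_right k).trans h2)
            (nsmul_le_nsmul_right inf_le_left k)
      _ ≤ (k • e - e * e)⁺ ⊓ k • b + e * e ⊓ k • b :=
          add_inf_le_inf_add_inf (posPart_nonneg _) hee h3
      _ ≤ 0 + e * e := by
          rw [inf_comm, h1]
          exact add_le_add le_rfl inf_le_left
      _ = e * e := zero_add _
  have hu : 0 ≤ b ⊓ (k • e - e * e)⁺ := le_inf hbnn (posPart_nonneg _)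
  obtain ⟨P, hP, huP⟩ := exists_isPrimeCone_notMem hu hk
  refine ⟨fun a => a⁺ ∈ P, hP.isPlace hF he (K := k) ?_ ?_, ε, hε, ?_⟩
  · intro heP
    refine huP (hP.mem_of_le _ _ hu (inf_le_right.trans ?_) (hP.nsmul_mem heP k))
    exact sup_le (sub_le_self _ hee) (nsmul_nonneg he k)
  · have h := posPart_inf_posPart_neg (k • e - e * e)
    rw [neg_sub, ← Nat.cast_smul_eq_nsmul ℝ k e] at h
    refine (hP.prime _ _ h).resolve_left fun h' => ?_
    rw [Nat.cast_smul_eq_nsmul] at h'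
    exact huP (hP.mem_of_le _ _ hu inf_le_right h')
  · intro h
    exact huP (hP.mem_of_le _ _ hu inf_le_left h)

end Place

section PlaceValue

variable {X : Type*} [Lattice X] [NonUnitalRing X] [Module ℝ X]

/-- `s` is the value of `z` relative to `e` in the total quotient described by `C`. -/
def HasPlaceValue (e : X) (C : X → Prop) (z : X) (s : ℝ) : Prop :=
  ∀ ε : ℝ, 0 < ε → C (z - (s + ε) • e) ∧ C ((s - ε) • e - z)

variable [IsOrderedAddMonoid X] [PosSMulMono ℝ X] {e : X} {C : X → Prop}

theorem IsPlace.mono (hC : IsPlace e C) {a b : X} (hab : a ≤ b) (hb : C b) : C a := by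
  have h := hC.add b (a - b) hb (hC.of_nonpos _ (sub_nonpos.mpr hab))
  rwa [add_sub_cancel] at h

theorem IsPlace.not_smul (hC : IsPlace e C) {c : ℝ} (hc : 0 < c) : ¬ C (c • e) := by
  intro h
  have := hC.smul c⁻¹ _ (inv_pos.mpr hc).le h
  rw [inv_smul_smul₀ hc.ne'] at this
  exact hC.notMem this

theorem HasPlaceValue.add (hC : IsPlace e C) {z w : X} {s t : ℝ} (hz : HasPlaceValue e C z s)
    (hw : HasPlaceValue e C w t) : HasPlaceValue e C (z + w) (s + t) := by
  intro ε hε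
  obtain ⟨h1, h2⟩ := hz (ε / 2) (half_pos hε)
  obtain ⟨h3, h4⟩ := hw (ε / 2) (half_pos hε)
  constructor
  · convert hC.add _ _ h1 h3 using 1
    module
  · convert hC.add _ _ h2 h4 using 1
    module

theorem HasPlaceValue.neg {z : X} {s : ℝ} (hz : HasPlaceValue e C z s) :
    HasPlaceValue e C (-z) (-s) := by
  intro ε hε
  obtain ⟨h1, h2⟩ := hz ε hε
  constructor
  · convert h2 using 1
    module
  · convert h1 using 1
    module

theorem hasPlaceValue_zero (hC : IsPlace e C) (he : 0 ≤ e) : HasPlaceValue e C 0 0 := by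
  intro ε hε
  have h := smul_nonneg hε.le he
  constructor <;> apply hC.of_nonpos <;> simpa using h

theorem hasPlaceValue_self (hC : IsPlace e C) (he : 0 ≤ e) : HasPlaceValue e C e 1 := by
  intro ε hε
  have h := smul_nonneg hε.le he
  constructor
  · apply hC.of_nonpos
    rw [show e - (1 + ε) • e = -(ε • e) by module]
    exact neg_nonpos.mpr h
  · apply hC.of_nonpos
    rw [show (1 - ε) • e - e = -(ε • e) by module]
    exact neg_nonpos.mpr h

theorem HasPlaceValue.smul (hC : IsPlace e C) (he : 0 ≤ e) {z : X} {s : ℝ}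
    (hz : HasPlaceValue e C z s) (c : ℝ) : HasPlaceValue e C (c • z) (c * s) := by
  have key : ∀ (c : ℝ), 0 ≤ c → HasPlaceValue e C (c • z) (c * s) := by
    intro c hc
    rcases hc.eq_or_lt with rfl | hc
    · simpa using hasPlaceValue_zero hC he
    intro ε hε
    obtain ⟨h1, h2⟩ := hz (ε / c) (div_pos hε hc)
    constructor
    · convert hC.smul c _ hc.le h1 using 1
      rw [smul_sub, smul_smul, mul_add, mul_div_cancel₀ _ hc.ne']
    · convert hC.smul c _ hc.le h2 using 1
      rw [smul_sub, smul_smul, mul_sub, mul_div_cancel₀ _ hc.ne']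
  rcases le_total 0 c with hc | hc
  · exact key c hc
  · simpa using (key (-c) (neg_nonneg.mpr hc)).neg

theorem HasPlaceValue.sub (hC : IsPlace e C) {z w : X} {s t : ℝ} (hz : HasPlaceValue e C z s)
    (hw : HasPlaceValue e C w t) : HasPlaceValue e C (z - w) (s - t) := by
  simpa [sub_eq_add_neg] using hz.add hC hw.neg

theorem HasPlaceValue.sup (hC : IsPlace e C) (he : 0 ≤ e) {z w : X} {s t : ℝ}
    (hz : HasPlaceValue e C z s) (hw : HasPlaceValue e C w t) :
    HasPlaceValue e C (z ⊔ w) (s ⊔ t) := by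
  intro ε hε
  obtain ⟨h1, h2⟩ := hz ε hε
  obtain ⟨h3, h4⟩ := hw ε hε
  constructor
  · rw [sup_sub]
    refine hC.sup _ _ (hC.mono ?_ h1) (hC.mono ?_ h3)
    · exact sub_le_sub_left (smul_le_smul_of_nonneg_right (by gcongr; exact le_sup_left) he) z
    · exact sub_le_sub_left (smul_le_smul_of_nonneg_right (by gcongr; exact le_sup_right) he) w
  · rcases le_total s t with hst | hst
    · rw [sup_eq_right.mpr hst]
      exact hC.mono (sub_le_sub_left le_sup_right _) h4
    · rw [sup_eq_left.mpr hst]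
      exact hC.mono (sub_le_sub_left le_sup_left _) h2

theorem IsPlace.exists_hasPlaceValue (hC : IsPlace e C) (he : 0 ≤ e) {z : X} {k : ℝ}
    (h1 : C (z - k • e)) (h2 : C (-(k • e) - z)) : ∃ s, HasPlaceValue e C z s := by
  set S : Set ℝ := {l | C (z - l • e)} with hS
  have hbdd : BddBelow S := by
    refine ⟨-k, fun l hl => ?_⟩
    by_contra! hlt
    refine hC.not_smul (sub_pos.mpr hlt) ?_
    convert hC.add _ _ hl h2 using 1
    module
  refine ⟨sInf S, fun ε hε => ⟨?_, ?_⟩⟩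
  · obtain ⟨l, hl, hlt⟩ := exists_lt_of_csInf_lt ⟨k, h1⟩ (lt_add_of_pos_right (sInf S) hε)
    exact hC.mono (sub_le_sub_left (smul_le_smul_of_nonneg_right hlt.le he) z) hl
  · rcases hC.total (z - (sInf S - ε) • e) with h | h
    · exact absurd (csInf_le hbdd h) (by linarith)
    · rwa [neg_sub] at h

variable [PosMulMono X] [MulPosMono X]

theorem IsPlace.exists_hasPlaceValue_sq (hC : IsPlace e C) (he : 0 ≤ e) :
    ∃ μ : ℝ, 0 ≤ μ ∧ HasPlaceValue e C (e * e) μ := by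
  obtain ⟨K, hK⟩ := hC.exists_sq_le
  have hee : 0 ≤ e * e := mul_nonneg he he
  obtain ⟨μ, hμ⟩ := hC.exists_hasPlaceValue he (z := e * e) (k := |K|)
    (hC.mono (sub_le_sub_left (smul_le_smul_of_nonneg_right (le_abs_self K) he) _) hK)
    (hC.of_nonpos _ (sub_nonpos.mpr
      ((neg_nonpos.mpr (smul_nonneg (abs_nonneg K) he)).trans hee)))
  refine ⟨μ, ?_, hμ⟩
  by_contra! hlt
  have h := (hμ (-μ / 2) (by linarith)).1
  refine hC.not_smul (c := -μ / 2) (by linarith) (hC.mono ?_ h)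
  rw [show e * e - (μ + -μ / 2) • e = (-μ / 2) • e + e * e by module]
  exact le_add_of_nonneg_right hee

variable [IsScalarTower ℝ X X] [SMulCommClass ℝ X X]

theorem HasPlaceValue.mul_of_nonneg (hC : IsPlace e C) (he : 0 ≤ e) {z w : X} {t : ℝ}
    (hz : HasPlaceValue e C z 0) (hw : HasPlaceValue e C w t) (hz0 : 0 ≤ z) (hw0 : 0 ≤ w) :
    HasPlaceValue e C (z * w) 0 ∧ HasPlaceValue e C (w * z) 0 := by
  obtain ⟨K, hK⟩ := hC.exists_sq_le
  have hk : 0 < |t| + 2 := by positivity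
  have hL : 0 < |K| + 1 := by positivity
  have hK' : C (e * e - (|K| + 1) • e) :=
    hC.mono (sub_le_sub_left (smul_le_smul_of_nonneg_right
      ((le_abs_self K).trans (le_add_of_nonneg_right zero_le_one)) he) _) hK
  have hw' : C (w - (|t| + 1) • e) :=
    hC.mono (sub_le_sub_left (smul_le_smul_of_nonneg_right (by gcongr; exact le_abs_self t) he) _)
      (hw 1 one_pos).1
  have lower : ∀ (a : X) (ε : ℝ), 0 < ε → 0 ≤ a → C ((0 - ε) • e - a) := by
    intro a ε hε ha
    refine hC.of_nonpos _ (sub_nonpos.mpr (le_trans ?_ ha))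
    rw [zero_sub, neg_smul, neg_nonpos]
    exact smul_nonneg hε.le he
  have hδ : ∀ ε : ℝ, 0 < ε → ∃ δ : ℝ, 0 < δ ∧ ε = 2 * δ * (|t| + 2) * (|K| + 1) := by
    intro ε hε
    refine ⟨ε / (2 * (|t| + 2) * (|K| + 1)), by positivity, ?_⟩
    field_simp
  constructor
  · refine fun ε hε => ⟨?_, lower _ ε hε (mul_nonneg hz0 hw0)⟩
    obtain ⟨δ, hδ0, hδε⟩ := hδ ε hε
    have h1 := hC.mul_right _ w δ (hz δ hδ0).1 hδ0 hw0
    have h2 := hC.mul_left _ e 1 hw' one_pos he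
    have h3 := hC.add _ _ (hC.add _ _ h1 (hC.smul (2 * δ) _ (by positivity) h2))
      (hC.smul (2 * δ * (|t| + 2)) _ (by positivity) hK')
    convert h3 using 1
    rw [hδε]
    simp only [sub_mul, mul_sub, smul_mul_assoc, mul_smul_comm]
    module
  · refine fun ε hε => ⟨?_, lower _ ε hε (mul_nonneg hw0 hz0)⟩
    obtain ⟨δ, hδ0, hδε⟩ := hδ ε hε
    have h1 := hC.mul_left _ w δ (hz δ hδ0).1 hδ0 hw0
    have h2 := hC.mul_right _ e 1 hw' one_pos he
    have h3 := hC.add _ _ (hC.add _ _ h1 (hC.smul (2 * δ) _ (by positivity) h2))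
      (hC.smul (2 * δ * (|t| + 2)) _ (by positivity) hK')
    convert h3 using 1
    rw [hδε]
    simp only [sub_mul, mul_sub, smul_mul_assoc, mul_smul_comm]
    module

theorem HasPlaceValue.mul_zero (hC : IsPlace e C) (he : 0 ≤ e) {z w : X} {t : ℝ}
    (hz : HasPlaceValue e C z 0) (hw : HasPlaceValue e C w t) :
    HasPlaceValue e C (z * w) 0 ∧ HasPlaceValue e C (w * z) 0 := by
  have h0 := hasPlaceValue_zero hC he
  have hz1 : HasPlaceValue e C z⁺ 0 := by simpa [posPart] using hz.sup hC he h0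
  have hz2 : HasPlaceValue e C z⁻ 0 := by simpa [negPart] using hz.neg.sup hC he h0
  have hw1 : HasPlaceValue e C w⁺ (t ⊔ 0) := hw.sup hC he h0
  have hw2 : HasPlaceValue e C w⁻ (-t ⊔ 0) := hw.neg.sup hC he h0
  have h11 := hz1.mul_of_nonneg hC he hw1 (posPart_nonneg z) (posPart_nonneg w)
  have h12 := hz1.mul_of_nonneg hC he hw2 (posPart_nonneg z) (negPart_nonneg w)
  have h21 := hz2.mul_of_nonneg hC he hw1 (negPart_nonneg z) (posPart_nonneg w)
  have h22 := hz2.mul_of_nonneg hC he hw2 (negPart_nonneg z) (negPart_nonneg w)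
  rw [← posPart_sub_negPart z, ← posPart_sub_negPart w]
  simp only [sub_mul, mul_sub]
  constructor
  · simpa using (h11.1.sub hC h21.1).sub hC (h12.1.sub hC h22.1)
  · simpa using (h11.2.sub hC h12.2).sub hC (h21.2.sub hC h22.2)

theorem HasPlaceValue.mul (hC : IsPlace e C) (he : 0 ≤ e) {z w : X} {s t μ : ℝ}
    (hμ : HasPlaceValue e C (e * e) μ) (hz : HasPlaceValue e C z s)
    (hw : HasPlaceValue e C w t) : HasPlaceValue e C (z * w) (μ * s * t) := by
  have h1 := hasPlaceValue_self hC he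
  have hz' : HasPlaceValue e C (z - s • e) 0 := by
    simpa using hz.sub hC (h1.smul hC he s)
  have hw' : HasPlaceValue e C (w - t • e) 0 := by
    simpa using hw.sub hC (h1.smul hC he t)
  have h := ((hz'.mul_zero hC he hw).1.add hC ((hw'.mul_zero hC he h1).2.smul hC he s)).add hC
    (hμ.smul hC he (s * t))
  convert h using 1
  · simp only [sub_mul, mul_sub, smul_mul_assoc, mul_smul_comm]
    module
  · ring

end PlaceValue

section LatAlgClosure

/-- The sublattice-algebra generated by a set. -/
inductive LatAlgClosure {Y : Type*} [Lattice Y] [NonUnitalRing Y] [Module ℝ Y] (s : Set Y) :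
    Y → Prop
  | basic (a : Y) : a ∈ s → LatAlgClosure s a
  | zero : LatAlgClosure s 0
  | add (a b : Y) : LatAlgClosure s a → LatAlgClosure s b → LatAlgClosure s (a + b)
  | smul (c : ℝ) (a : Y) : LatAlgClosure s a → LatAlgClosure s (c • a)
  | sup (a b : Y) : LatAlgClosure s a → LatAlgClosure s b → LatAlgClosure s (a ⊔ b)
  | mul (a b : Y) : LatAlgClosure s a → LatAlgClosure s b → LatAlgClosure s (a * b)

namespace LatAlgClosure

variable {Y : Type*} [Lattice Y] [NonUnitalRing Y] [Module ℝ Y] {s : Set Y} {a b : Y}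

theorem neg (ha : LatAlgClosure s a) : LatAlgClosure s (-a) := by
  simpa using LatAlgClosure.smul (-1) a ha

theorem sub (ha : LatAlgClosure s a) (hb : LatAlgClosure s b) : LatAlgClosure s (a - b) := by
  rw [sub_eq_add_neg]
  exact add _ _ ha hb.neg

theorem abs (ha : LatAlgClosure s a) : LatAlgClosure s |a| := sup _ _ ha ha.neg

theorem sum {ι : Type*} (t : Finset ι) (f : ι → Y) (hf : ∀ i ∈ t, LatAlgClosure s (f i)) :
    LatAlgClosure s (∑ i ∈ t, f i) :=
  Finset.sum_induction f _ add zero hf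

theorem inf [IsOrderedAddMonoid Y] (ha : LatAlgClosure s a) (hb : LatAlgClosure s b) :
    LatAlgClosure s (a ⊓ b) := by
  rw [← neg_neg (a ⊓ b), neg_inf]
  exact (sup _ _ ha.neg hb.neg).neg

end LatAlgClosure

end LatAlgClosure

section AbsMul

variable {X : Type*} [Lattice X] [NonUnitalRing X] [IsOrderedAddMonoid X] [PosMulMono X]

theorem abs_mul_le_mul_abs (a b : X) : |a * b| ≤ |a| * |b| := by
  have h11 := mul_nonneg (posPart_nonneg a) (posPart_nonneg b)
  have h12 := mul_nonneg (posPart_nonneg a) (negPart_nonneg b)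
  have h21 := mul_nonneg (negPart_nonneg a) (posPart_nonneg b)
  have h22 := mul_nonneg (negPart_nonneg a) (negPart_nonneg b)
  have e1 : a * b = (a⁺ - a⁻) * (b⁺ - b⁻) := by rw [posPart_sub_negPart, posPart_sub_negPart]
  have e2 : |a| * |b| = (a⁺ + a⁻) * (b⁺ + b⁻) := by rw [posPart_add_negPart, posPart_add_negPart]
  rw [e1, e2, abs_le']
  constructor <;> rw [← sub_nonneg]
  · have : (a⁺ + a⁻) * (b⁺ + b⁻) - (a⁺ - a⁻) * (b⁺ - b⁻)
        = a⁺ * b⁻ + a⁺ * b⁻ + (a⁻ * b⁺ + a⁻ * b⁺) := by noncomm_ring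
    rw [this]
    positivity
  · have : (a⁺ + a⁻) * (b⁺ + b⁻) - -((a⁺ - a⁻) * (b⁺ - b⁻))
        = a⁺ * b⁺ + a⁺ * b⁺ + (a⁻ * b⁻ + a⁻ * b⁻) := by noncomm_ring
    rw [this]
    positivity

end AbsMul

section CoordGraph

variable {X : Type*} [Lattice X] [NonUnitalRing X] [Module ℝ X] {n : ℕ}

/-- The pairs `(πᵢ, xᵢ)` of a coordinate function and its prescribed value. -/
def coordGraph (x : Fin n → X) : Set (((Fin n → ℝ) → ℝ) × X) :=
  Set.range fun i => (fun t => t i, x i)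

variable [IsOrderedAddMonoid X] [PosSMulMono ℝ X] [PosMulMono X] [MulPosMono X]
  [IsScalarTower ℝ X X] [SMulCommClass ℝ X X] {x : Fin n → X}

open Filter Topology in
theorem exists_hasPlaceValue_of_coordGraph {e : X} {C : X → Prop} (hC : IsPlace e C) (he : 0 ≤ e)
    {μ : ℝ} (hμ0 : 0 ≤ μ) (hμ : HasPlaceValue e C (e * e) μ) {s : Fin n → ℝ}
    (hs : ∀ i, HasPlaceValue e C (x i) (s i)) {p : ((Fin n → ℝ) → ℝ) × X}
    (hp : LatAlgClosure (coordGraph x) p) :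
    ∃ a, HasPlaceValue e C p.2 a ∧ Tendsto (fun τ : ℝ => p.1 (τ • s) / τ) (𝓝[>] μ) (𝓝 a) := by
  have hpos : ∀ᶠ τ : ℝ in 𝓝[>] μ, 0 < τ := by
    filter_upwards [self_mem_nhdsWithin] with τ hτ using hμ0.trans_lt hτ
  induction hp with
  | basic a ha =>
    obtain ⟨i, rfl⟩ := ha
    refine ⟨s i, hs i, Tendsto.congr' ?_ tendsto_const_nhds⟩
    filter_upwards [hpos] with τ hτ
    simp [mul_div_cancel_left₀ _ hτ.ne']
  | zero => exact ⟨0, hasPlaceValue_zero hC he, by simp⟩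
  | add p q _ _ ihp ihq =>
    obtain ⟨a, ha, hta⟩ := ihp
    obtain ⟨b, hb, htb⟩ := ihq
    refine ⟨a + b, ha.add hC hb, (hta.add htb).congr fun τ => ?_⟩
    simp [add_div]
  | smul c p _ ihp =>
    obtain ⟨a, ha, hta⟩ := ihp
    refine ⟨c * a, ha.smul hC he c, (hta.const_mul c).congr fun τ => ?_⟩
    simp [mul_div_assoc]
  | sup p q _ _ ihp ihq =>
    obtain ⟨a, ha, hta⟩ := ihp
    obtain ⟨b, hb, htb⟩ := ihq
    refine ⟨a ⊔ b, ha.sup hC he hb, (hta.sup_nhds htb).congr' ?_⟩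
    filter_upwards [hpos] with τ hτ
    exact (max_div_div_right hτ.le _ _)
  | mul p q _ _ ihp ihq =>
    obtain ⟨a, ha, hta⟩ := ihp
    obtain ⟨b, hb, htb⟩ := ihq
    have hid : Tendsto (fun τ : ℝ => τ) (𝓝[>] μ) (𝓝 μ) := tendsto_nhdsWithin_of_tendsto_nhds
      tendsto_id
    refine ⟨μ * a * b, HasPlaceValue.mul hC he hμ ha hb, ((hid.mul hta).mul htb).congr' ?_⟩
    filter_upwards [hpos] with τ hτ
    simp only [Prod.fst_mul, Pi.mul_apply]
    field_simp

theorem abs_inf_eq_zero_of_coordGraph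
    (hF : ∀ a b z : X, a ⊓ b = 0 → 0 ≤ z → (z * a) ⊓ b = 0 ∧ (a * z) ⊓ b = 0)
    {b : X} (hb : ∀ i, |x i| ⊓ b = 0) (hb0 : 0 ≤ b) {p : ((Fin n → ℝ) → ℝ) × X}
    (hp : LatAlgClosure (coordGraph x) p) : |p.2| ⊓ b = 0 := by
  induction hp with
  | basic a ha =>
    obtain ⟨i, rfl⟩ := ha
    exact hb i
  | zero => simpa using hb0
  | add p q _ _ ihp ihq =>
    exact inf_eq_zero_of_le (abs_nonneg _) hb0 (add_inf_eq_zero ihp ihq) (abs_add_le _ _)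
  | smul c p _ ihp =>
    obtain ⟨k, hk⟩ := exists_nat_ge |c|
    refine inf_eq_zero_of_le (abs_nonneg _) hb0 (nsmul_inf_eq_zero ihp k) ?_
    rw [← Nat.cast_smul_eq_nsmul ℝ]
    have h1 : ∀ a : X, c • a ≤ (k : ℝ) • |a| := by
      intro a
      refine le_trans ?_ (smul_le_smul_of_nonneg_right hk (abs_nonneg a))
      rcases le_total 0 c with hc | hc
      · rw [abs_of_nonneg hc]
        exact smul_le_smul_of_nonneg_left (le_abs_self a) hc
      · rw [abs_of_nonpos hc, ← neg_smul_neg]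
        exact smul_le_smul_of_nonneg_left (neg_le_abs a) (neg_nonneg.mpr hc)
    refine abs_le'.mpr ⟨h1 _, ?_⟩
    have := h1 (-p.2)
    rwa [abs_neg, smul_neg] at this
  | sup p q _ _ ihp ihq =>
    refine inf_eq_zero_of_le (abs_nonneg _) hb0 (add_inf_eq_zero ihp ihq) (abs_le'.mpr ⟨?_, ?_⟩)
    · exact sup_le ((le_abs_self _).trans (le_add_of_nonneg_right (abs_nonneg _)))
        ((le_abs_self _).trans (le_add_of_nonneg_left (abs_nonneg _)))
    · exact (neg_le_neg le_sup_left).trans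
        ((neg_le_abs p.2).trans (le_add_of_nonneg_right (abs_nonneg _)))
  | mul p q _ _ ihp ihq =>
    exact inf_eq_zero_of_le (abs_nonneg _) hb0 (hF _ _ _ ihp (abs_nonneg q.2)).2
      (abs_mul_le_mul_abs _ _)

theorem eq_zero_of_coordGraph
    (hA : ∀ a b : X, 0 ≤ a → 0 ≤ b → (∀ k : ℕ, k • a ≤ b) → a = 0)
    (hF : ∀ a b z : X, a ⊓ b = 0 → 0 ≤ z → (z * a) ⊓ b = 0 ∧ (a * z) ⊓ b = 0)
    {p : ((Fin n → ℝ) → ℝ) × X} (hp : LatAlgClosure (coordGraph x) p) (hp1 : p.1 = 0)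
    (hp2 : 0 ≤ p.2) : p.2 = 0 := by
  by_contra hne
  set e : X := ∑ i, |x i| with he_def
  have he : 0 ≤ e := Finset.sum_nonneg fun i _ => abs_nonneg (x i)
  have hxe : ∀ i, |x i| ≤ e := fun i =>
    Finset.single_le_sum (f := fun i => |x i|) (fun i _ => abs_nonneg (x i)) (Finset.mem_univ i)
  obtain ⟨C, hC, ε, hε, hCε⟩ := exists_isPlace_not hA hF he hp2 hne fun b hbe => by
    have hb0 : 0 ≤ b := hbe ▸ inf_le_left
    have h := abs_inf_eq_zero_of_coordGraph hF (b := b) (x := x) (fun i =>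
      inf_eq_zero_of_le (abs_nonneg _) hb0 (by rwa [inf_comm]) (hxe i)) hb0 hp
    exact inf_eq_zero_of_le hp2 hb0 h (le_abs_self _)
  obtain ⟨μ, hμ0, hμ⟩ := hC.exists_hasPlaceValue_sq he
  have hval : ∀ i, ∃ s, HasPlaceValue e C (x i) s := fun i =>
    hC.exists_hasPlaceValue he (k := 1)
      (hC.of_nonpos _ (by simpa using (le_abs_self (x i)).trans (hxe i)))
      (hC.of_nonpos _ (by simpa [neg_le] using (neg_le_abs (x i)).trans (hxe i)))
  choose s hs using hval
  obtain ⟨a, ha, hlim⟩ := exists_hasPlaceValue_of_coordGraph hC he hμ0 hμ hs hp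
  have ha0 : a = 0 := tendsto_nhds_unique hlim (by simp [hp1])
  have := (ha ε hε).1
  rw [ha0, zero_add] at this
  exact hCε this

theorem nonneg_of_coordGraph
    (hA : ∀ a b : X, 0 ≤ a → 0 ≤ b → (∀ k : ℕ, k • a ≤ b) → a = 0)
    (hF : ∀ a b z : X, a ⊓ b = 0 → 0 ≤ z → (z * a) ⊓ b = 0 ∧ (a * z) ⊓ b = 0)
    {p : ((Fin n → ℝ) → ℝ) × X} (hp : LatAlgClosure (coordGraph x) p) (hp1 : 0 ≤ p.1) :
    0 ≤ p.2 := by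
  have h := eq_zero_of_coordGraph hA hF (LatAlgClosure.sup _ _ hp.neg .zero)
    (sup_eq_right.mpr (neg_nonpos.mpr hp1)) (posPart_nonneg (-p.2))
  exact neg_nonpos.mp (posPart_eq_zero.mp h)

theorem le_of_coordGraph
    (hA : ∀ a b : X, 0 ≤ a → 0 ≤ b → (∀ k : ℕ, k • a ≤ b) → a = 0)
    (hF : ∀ a b z : X, a ⊓ b = 0 → 0 ≤ z → (z * a) ⊓ b = 0 ∧ (a * z) ⊓ b = 0)
    {p q : ((Fin n → ℝ) → ℝ) × X} (hp : LatAlgClosure (coordGraph x) p)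
    (hq : LatAlgClosure (coordGraph x) q) (h : p.1 ≤ q.1) : p.2 ≤ q.2 :=
  sub_nonneg.mp (nonneg_of_coordGraph hA hF (hq.sub hp) (sub_nonneg.mpr h))

end CoordGraph

section RegNorm

variable {X : Type*} [Lattice X] [AddCommGroup X] [Module ℝ X]

theorem regNorm_le {e x : X} {c : ℝ} (hc : 0 ≤ c) (h : |x| ≤ c • e) : regNorm e x ≤ c :=
  csInf_le ⟨0, fun _ hd => hd.1⟩ ⟨hc, h⟩

variable [IsOrderedAddMonoid X] [PosSMulMono ℝ X]

theorem abs_le_smul_of_regNorm_lt {e x : X} (he : 0 ≤ e) (hx : x ∈ idealSet e) {c : ℝ}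
    (h : regNorm e x < c) : |x| ≤ c • e := by
  obtain ⟨d, ⟨-, hd⟩, hdc⟩ := exists_lt_of_csInf_lt hx h
  exact hd.trans (smul_le_smul_of_nonneg_right hdc.le he)

theorem abs_sup_sub_sup_le_add (a b c d : X) : |a ⊔ b - c ⊔ d| ≤ |a - c| + |b - d| := by
  have h1 := abs_sup_sub_sup_le_abs a c b
  have h2 := abs_sup_sub_sup_le_abs b d c
  rw [sup_comm b c, sup_comm d c] at h2
  calc |a ⊔ b - c ⊔ d| = |(a ⊔ b - c ⊔ b) + (c ⊔ b - c ⊔ d)| := by rw [sub_add_sub_cancel]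
    _ ≤ _ := (abs_add_le _ _).trans (add_le_add h1 h2)

theorem abs_smul_le (c : ℝ) (a : X) : |c • a| ≤ |c| • |a| := by
  have h1 : ∀ a : X, c • a ≤ |c| • |a| := by
    intro a
    rcases le_total 0 c with hc | hc
    · rw [abs_of_nonneg hc]
      exact smul_le_smul_of_nonneg_left (le_abs_self a) hc
    · rw [abs_of_nonpos hc, ← neg_smul_neg]
      exact smul_le_smul_of_nonneg_left (neg_le_abs a) (neg_nonneg.mpr hc)
  refine abs_le'.mpr ⟨h1 _, ?_⟩
  have := h1 (-a)
  rwa [abs_neg, smul_neg] at this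

end RegNorm

section RUClosure

/-- The relative uniform closure of the sublattice-algebra generated by a set. -/
def RUClosure {Y : Type*} [Lattice Y] [NonUnitalRing Y] [Module ℝ Y] (s : Set Y) (p : Y) : Prop :=
  ∃ E, LatAlgClosure s E ∧ 0 ≤ E ∧
    ∀ ε : ℝ, 0 < ε → ∃ q, LatAlgClosure s q ∧ |p - q| ≤ ε • E

namespace RUClosure

variable {Y : Type*} [Lattice Y] [NonUnitalRing Y] [Module ℝ Y] [IsOrderedAddMonoid Y]
  [PosSMulMono ℝ Y] {s : Set Y} {p q : Y}

theorem of_latAlgClosure (hp : LatAlgClosure s p) : RUClosure s p :=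
  ⟨0, .zero, le_rfl, fun ε _ => ⟨p, hp, by simp⟩⟩

theorem add (hp : RUClosure s p) (hq : RUClosure s q) : RUClosure s (p + q) := by
  obtain ⟨E, hE, hE0, hpE⟩ := hp
  obtain ⟨F, hF, hF0, hqF⟩ := hq
  refine ⟨E + F, .add _ _ hE hF, add_nonneg hE0 hF0, fun ε hε => ?_⟩
  obtain ⟨a, ha, hpa⟩ := hpE ε hε
  obtain ⟨b, hb, hqb⟩ := hqF ε hε
  refine ⟨a + b, .add _ _ ha hb, ?_⟩
  rw [add_sub_add_comm, smul_add]
  exact (abs_add_le _ _).trans (add_le_add hpa hqb)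

theorem smul (hp : RUClosure s p) (c : ℝ) : RUClosure s (c • p) := by
  obtain ⟨E, hE, hE0, hpE⟩ := hp
  refine ⟨|c| • E, .smul _ _ hE, smul_nonneg (abs_nonneg c) hE0, fun ε hε => ?_⟩
  obtain ⟨a, ha, hpa⟩ := hpE ε hε
  refine ⟨c • a, .smul _ _ ha, ?_⟩
  rw [← smul_sub, smul_comm]
  exact (abs_smul_le _ _).trans (smul_le_smul_of_nonneg_left hpa (abs_nonneg c))

theorem sup (hp : RUClosure s p) (hq : RUClosure s q) : RUClosure s (p ⊔ q) := by
  obtain ⟨E, hE, hE0, hpE⟩ := hp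
  obtain ⟨F, hF, hF0, hqF⟩ := hq
  refine ⟨E + F, .add _ _ hE hF, add_nonneg hE0 hF0, fun ε hε => ?_⟩
  obtain ⟨a, ha, hpa⟩ := hpE ε hε
  obtain ⟨b, hb, hqb⟩ := hqF ε hε
  refine ⟨a ⊔ b, .sup _ _ ha hb, ?_⟩
  rw [smul_add]
  exact (abs_sup_sub_sup_le_add _ _ _ _).trans (add_le_add hpa hqb)

theorem mul [PosMulMono Y] [MulPosMono Y] [IsScalarTower ℝ Y Y] [SMulCommClass ℝ Y Y]
    (hp : RUClosure s p) (hq : RUClosure s q) : RUClosure s (p * q) := by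
  obtain ⟨E, hE, hE0, hpE⟩ := hp
  obtain ⟨F, hF, hF0, hqF⟩ := hq
  obtain ⟨a₁, ha₁, hpa₁⟩ := hpE 1 one_pos
  obtain ⟨b₁, hb₁, hqb₁⟩ := hqF 1 one_pos
  rw [one_smul] at hpa₁ hqb₁
  have hp' : |p| ≤ |a₁| + E := by
    calc |p| = |a₁ + (p - a₁)| := by rw [add_sub_cancel]
      _ ≤ _ := (abs_add_le _ _).trans (add_le_add le_rfl hpa₁)
  have hq' : |q| ≤ |b₁| + F := by
    calc |q| = |b₁ + (q - b₁)| := by rw [add_sub_cancel]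
      _ ≤ _ := (abs_add_le _ _).trans (add_le_add le_rfl hqb₁)
  have hG0 : 0 ≤ |b₁| + F := add_nonneg (abs_nonneg _) hF0
  have hH0 : 0 ≤ |a₁| + E + E := add_nonneg (add_nonneg (abs_nonneg _) hE0) hE0
  have hN : 0 ≤ E * (|b₁| + F) + (|a₁| + E + E) * F :=
    add_nonneg (mul_nonneg hE0 hG0) (mul_nonneg hH0 hF0)
  refine ⟨E * (|b₁| + F) + (|a₁| + E + E) * F, .add _ _ (.mul _ _ hE (.add _ _ hb₁.abs hF))
    (.mul _ _ (.add _ _ (.add _ _ ha₁.abs hE) hE) hF), hN, fun ε hε => ?_⟩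
  have hδ : 0 < min ε 1 := lt_min hε one_pos
  obtain ⟨a, ha, hpa⟩ := hpE (min ε 1) hδ
  obtain ⟨b, hb, hqb⟩ := hqF (min ε 1) hδ
  have ha' : |a| ≤ |a₁| + E + E := by
    calc |a| = |p + (a - p)| := by rw [add_sub_cancel]
      _ ≤ |p| + |a - p| := abs_add_le _ _
      _ ≤ (|a₁| + E) + E := by
        refine add_le_add hp' ?_
        rw [abs_sub_comm]
        refine hpa.trans ?_
        simpa using smul_le_smul_of_nonneg_right (min_le_right ε 1) hE0
  refine ⟨a * b, .mul _ _ ha hb, ?_⟩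
  calc |p * q - a * b| = |(p - a) * q + a * (q - b)| := by rw [sub_mul, mul_sub]; congr 1; abel
    _ ≤ |p - a| * |q| + |a| * |q - b| := (abs_add_le _ _).trans
        (add_le_add (abs_mul_le_mul_abs _ _) (abs_mul_le_mul_abs _ _))
    _ ≤ (min ε 1 • E) * (|b₁| + F) + (|a₁| + E + E) * (min ε 1 • F) := by
        refine add_le_add ?_ ?_
        · exact (mul_le_mul_of_nonneg_right hpa (abs_nonneg q)).trans
            (mul_le_mul_of_nonneg_left hq' (smul_nonneg hδ.le hE0))
        · exact (mul_le_mul_of_nonneg_left hqb (abs_nonneg a)).trans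
            (mul_le_mul_of_nonneg_right ha' (smul_nonneg hδ.le hF0))
    _ = min ε 1 • (E * (|b₁| + F) + (|a₁| + E + E) * F) := by
        rw [smul_mul_assoc, mul_smul_comm, smul_add]
    _ ≤ _ := smul_le_smul_of_nonneg_right (min_le_left ε 1) hN

end RUClosure

end RUClosure

section Calculus

instance Prod.instPosMulMonoOfComponents {A B : Type*} [Preorder A] [Preorder B]
    [NonUnitalRing A] [NonUnitalRing B] [PosMulMono A] [PosMulMono B] : PosMulMono (A × B) where
  mul_le_mul_of_nonneg_left _ ha _ _ hbc :=
    ⟨mul_le_mul_of_nonneg_left hbc.1 ha.1, mul_le_mul_of_nonneg_left hbc.2 ha.2⟩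

instance Prod.instMulPosMonoOfComponents {A B : Type*} [Preorder A] [Preorder B]
    [NonUnitalRing A] [NonUnitalRing B] [MulPosMono A] [MulPosMono B] : MulPosMono (A × B) where
  mul_le_mul_of_nonneg_right _ ha _ _ hbc :=
    ⟨mul_le_mul_of_nonneg_right hbc.1 ha.1, mul_le_mul_of_nonneg_right hbc.2 ha.2⟩

variable {X : Type*} [Lattice X] [NonUnitalRing X] [Module ℝ X] {n : ℕ}

/-- The coordinate functions on `ℝⁿ`. -/
def coordFun (n : ℕ) : Set ((Fin n → ℝ) → ℝ) := Set.range fun i t => t i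

theorem exists_latAlgClosure_coordGraph (x : Fin n → X) {f : (Fin n → ℝ) → ℝ}
    (hf : LatAlgClosure (coordFun n) f) : ∃ y, LatAlgClosure (coordGraph x) (f, y) := by
  induction hf with
  | basic a ha =>
    obtain ⟨i, rfl⟩ := ha
    exact ⟨x i, .basic _ ⟨i, rfl⟩⟩
  | zero => exact ⟨0, .zero⟩
  | add f g _ _ ihf ihg =>
    obtain ⟨y, hy⟩ := ihf
    obtain ⟨z, hz⟩ := ihg
    exact ⟨y + z, .add _ _ hy hz⟩
  | smul c f _ ihf =>
    obtain ⟨y, hy⟩ := ihf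
    exact ⟨c • y, .smul _ _ hy⟩
  | sup f g _ _ ihf ihg =>
    obtain ⟨y, hy⟩ := ihf
    obtain ⟨z, hz⟩ := ihg
    exact ⟨y ⊔ z, .sup _ _ hy hz⟩
  | mul f g _ _ ihf ihg =>
    obtain ⟨y, hy⟩ := ihf
    obtain ⟨z, hz⟩ := ihg
    exact ⟨y * z, .mul _ _ hy hz⟩

variable [IsOrderedAddMonoid X] [PosSMulMono ℝ X] [PosMulMono X] [MulPosMono X]
  [IsScalarTower ℝ X X] [SMulCommClass ℝ X X] {x : Fin n → X}

theorem RUClosure.snd_unique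
    (hA : ∀ a b : X, 0 ≤ a → 0 ≤ b → (∀ k : ℕ, k • a ≤ b) → a = 0)
    (hF : ∀ a b z : X, a ⊓ b = 0 → 0 ≤ z → (z * a) ⊓ b = 0 ∧ (a * z) ⊓ b = 0)
    {f : (Fin n → ℝ) → ℝ} {y z : X} (hy : RUClosure (coordGraph x) (f, y))
    (hz : RUClosure (coordGraph x) (f, z)) : y = z := by
  obtain ⟨E, hE, hE0, h⟩ := hy.add (hz.smul (-1))
  rw [← sub_eq_zero]
  refine eq_zero_of_forall_abs_le_smul hA hE0.2 fun ε hε => ?_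
  obtain ⟨q, hq, hpq⟩ := h (ε / 2) (half_pos hε)
  have h1 : |q.2| ≤ (ε / 2) • E.2 := by
    refine le_of_coordGraph hA hF hq.abs (.smul (ε / 2) _ hE) (hpq.1.trans' (le_of_eq ?_))
    change |q.1| = |f + (-1 : ℝ) • f - q.1|
    rw [neg_one_smul, add_neg_cancel, zero_sub, abs_neg]
  have h2 : |y + (-1 : ℝ) • z - q.2| ≤ (ε / 2) • E.2 := hpq.2
  calc |y - z| = |(y + (-1 : ℝ) • z - q.2) + q.2| := by
        rw [neg_one_smul, sub_add_cancel, sub_eq_add_neg]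
    _ ≤ (ε / 2) • E.2 + (ε / 2) • E.2 := (abs_add_le _ _).trans (add_le_add h2 h1)
    _ = ε • E.2 := by rw [← add_smul, add_halves]

theorem RUClosure.exists_snd
    (hA : ∀ a b : X, 0 ≤ a → 0 ≤ b → (∀ k : ℕ, k • a ≤ b) → a = 0)
    (hF : ∀ a b z : X, a ⊓ b = 0 → 0 ≤ z → (z * a) ⊓ b = 0 ∧ (a * z) ⊓ b = 0)
    (hU : UniformlyComplete X) (x : Fin n → X) {f : (Fin n → ℝ) → ℝ}
    (hf : RUClosure (coordFun n) f) : ∃ y, RUClosure (coordGraph x) (f, y) := by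
  obtain ⟨F, hFc, hF0, happ⟩ := hf
  obtain ⟨E, hE⟩ := exists_latAlgClosure_coordGraph x hFc
  have hE0 : 0 ≤ E := nonneg_of_coordGraph hA hF hE hF0
  have happ' : ∀ k : ℕ, ∃ q : ((Fin n → ℝ) → ℝ) × X, LatAlgClosure (coordGraph x) q ∧
      |f - q.1| ≤ (1 / ((k : ℝ) + 1)) • F := by
    intro k
    obtain ⟨g, hg, hfg⟩ := happ (1 / ((k : ℝ) + 1)) Nat.one_div_pos_of_nat
    obtain ⟨z, hz⟩ := exists_latAlgClosure_coordGraph x hg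
    exact ⟨(g, z), hz, hfg⟩
  choose q hq hfq using happ'
  have hcauchy : ∀ i j, |(q i).2 - (q j).2| ≤ (1 / ((i : ℝ) + 1) + 1 / ((j : ℝ) + 1)) • E := by
    intro i j
    refine le_of_coordGraph hA hF ((hq i).sub (hq j)).abs (.smul _ _ hE) ?_
    change |(q i).1 - (q j).1| ≤ (1 / ((i : ℝ) + 1) + 1 / ((j : ℝ) + 1)) • F
    rw [add_smul]
    calc |(q i).1 - (q j).1| = |((q i).1 - f) + (f - (q j).1)| := by rw [sub_add_sub_cancel]
      _ ≤ |(q i).1 - f| + |f - (q j).1| := abs_add_le _ _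
      _ ≤ _ := add_le_add (by rw [abs_sub_comm]; exact hfq i) (hfq j)
  have hsmall : ∀ ε : ℝ, 0 < ε → ∃ N : ℕ, ∀ k : ℕ, N ≤ k → 1 / ((k : ℝ) + 1) < ε := by
    intro ε hε
    obtain ⟨N, hN⟩ := exists_nat_one_div_lt hε
    exact ⟨N, fun k hk => (Nat.one_div_le_one_div hk).trans_lt hN⟩
  have hmem : ∀ k, (q k).2 - (q 0).2 ∈ idealSet E := fun k =>
    ⟨_, by positivity, hcauchy k 0⟩
  obtain ⟨y, hyE, hy⟩ := hU E hE0 (fun k => (q k).2 - (q 0).2) hmem (by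
    intro ε hε
    obtain ⟨N, hN⟩ := hsmall (ε / 2) (half_pos hε)
    refine ⟨N, fun i j hi hj => ?_⟩
    rw [sub_sub_sub_cancel_right]
    refine (regNorm_le (by positivity) (hcauchy i j)).trans_lt ?_
    linarith [hN i hi, hN j hj])
  have hdiff : ∀ k, (q k).2 - (q 0).2 - y ∈ idealSet E := by
    intro k
    obtain ⟨c, hc, hkc⟩ := hmem k
    obtain ⟨d, hd, hyd⟩ := hyE
    refine ⟨c + d, add_nonneg hc hd, ?_⟩
    rw [sub_eq_add_neg _ y, add_smul]
    exact (abs_add_le _ _).trans (add_le_add hkc (by rwa [abs_neg]))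
  refine ⟨y + (q 0).2, (F, E), hE, ⟨hF0, hE0⟩, fun ε hε => ?_⟩
  obtain ⟨N, hN⟩ := hsmall ε hε
  obtain ⟨M, hM⟩ := hy ε hε
  refine ⟨q (max N M), hq _, ?_, ?_⟩
  · refine (hfq (max N M)).trans (smul_le_smul_of_nonneg_right ?_ hF0)
    exact (hN _ (le_max_left N M)).le
  · change |y + (q 0).2 - (q (max N M)).2| ≤ ε • E
    rw [abs_sub_comm, ← sub_sub, sub_right_comm]
    exact abs_le_smul_of_regNorm_lt hE0 (hdiff _) (hM _ (le_max_right N M))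

theorem exists_isLatAlgHom_of_ruClosure
    (hA : ∀ a b : X, 0 ≤ a → 0 ≤ b → (∀ k : ℕ, k • a ≤ b) → a = 0)
    (hF : ∀ a b z : X, a ⊓ b = 0 → 0 ≤ z → (z * a) ⊓ b = 0 ∧ (a * z) ⊓ b = 0)
    (hU : UniformlyComplete X) {P : ((Fin n → ℝ) → ℝ) → Prop}
    (hP : ∀ f, P f → RUClosure (coordFun n) f) (x : Fin n → X) :
    ∃ Ψ : ∀ f : (Fin n → ℝ) → ℝ, P f → X, IsLatAlgHom P Ψ ∧
      ∀ (i : Fin n) (hi : P fun t => t i), Ψ (fun t => t i) hi = x i := by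
  choose Ψ hΨ using fun f hf => RUClosure.exists_snd hA hF hU x (hP f hf)
  refine ⟨Ψ, ⟨⟨?_, ?_, ?_⟩, ?_⟩, ?_⟩
  · exact fun f g hf hg hfg => (hΨ _ hfg).snd_unique hA hF ((hΨ f hf).add (hΨ g hg))
  · exact fun c f hf hcf => (hΨ _ hcf).snd_unique hA hF ((hΨ f hf).smul c)
  · exact fun f g hf hg hfg => (hΨ _ hfg).snd_unique hA hF ((hΨ f hf).sup (hΨ g hg))
  · exact fun f g hf hg hfg => (hΨ _ hfg).snd_unique hA hF ((hΨ f hf).mul (hΨ g hg))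
  · exact fun i hi => (hΨ _ hi).snd_unique hA hF (.of_latAlgClosure (.basic _ ⟨i, rfl⟩))

end Calculus

section Density

variable {n : ℕ}

/-- The `ℓ¹`-norm on `ℝⁿ`. -/
def l1 (t : Fin n → ℝ) : ℝ := ∑ i, |t i|

theorem l1_nonneg (t : Fin n → ℝ) : 0 ≤ l1 t := Finset.sum_nonneg fun i _ => abs_nonneg (t i)

theorem continuous_l1 : Continuous (l1 : (Fin n → ℝ) → ℝ) := by
  unfold l1
  fun_prop

theorem l1_smul (c : ℝ) (t : Fin n → ℝ) : l1 (c • t) = |c| * l1 t := by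
  simp [l1, abs_mul, Finset.mul_sum]

theorem abs_apply_le_l1 (t : Fin n → ℝ) (i : Fin n) : |t i| ≤ l1 t :=
  Finset.single_le_sum (f := fun i => |t i|) (fun i _ => abs_nonneg (t i)) (Finset.mem_univ i)

theorem norm_le_l1 (t : Fin n → ℝ) : ‖t‖ ≤ l1 t :=
  (pi_norm_le_iff_of_nonneg (l1_nonneg t)).mpr fun i => abs_apply_le_l1 t i

theorem eq_zero_of_l1_eq_zero {t : Fin n → ℝ} (h : l1 t = 0) : t = 0 :=
  norm_le_zero_iff.mp (h ▸ norm_le_l1 t)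

theorem isCompact_l1_le (R : ℝ) : IsCompact {t : Fin n → ℝ | l1 t ≤ R} :=
  Metric.isCompact_of_isClosed_isBounded (isClosed_le continuous_l1 continuous_const)
    ((Metric.isBounded_closedBall (x := (0 : Fin n → ℝ)) (r := R)).subset fun t ht => by
      simpa using (norm_le_l1 t).trans ht)

theorem isCompact_l1_eq_one : IsCompact {t : Fin n → ℝ | l1 t = 1} :=
  (isCompact_l1_le 1).of_isClosed_subset (isClosed_eq continuous_l1 continuous_const)
    fun _ ht => le_of_eq ht

theorem latAlgClosure_l1 : LatAlgClosure (coordFun n) l1 := by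
  have h : (l1 : (Fin n → ℝ) → ℝ) = ∑ i, |fun t : Fin n → ℝ => t i| := by
    ext t
    simp [l1]
  rw [h]
  exact LatAlgClosure.sum _ _ fun i _ => .abs (.basic (fun t : Fin n → ℝ => t i) ⟨i, rfl⟩)

theorem latAlgClosure_l1_pow (k : ℕ) :
    LatAlgClosure (coordFun n) (fun t => l1 t ^ (k + 1)) := by
  induction k with
  | zero => simpa using latAlgClosure_l1
  | succ k ih => exact .mul _ _ ih latAlgClosure_l1

theorem LatAlgClosure.continuous {g : (Fin n → ℝ) → ℝ} (hg : LatAlgClosure (coordFun n) g) :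
    Continuous g := by
  induction hg with
  | basic a ha =>
    obtain ⟨i, rfl⟩ := ha
    exact continuous_apply i
  | zero => exact continuous_const
  | add f g _ _ ihf ihg => exact ihf.add ihg
  | smul c f _ ihf => exact ihf.const_smul c
  | sup f g _ _ ihf ihg => exact ihf.sup ihg
  | mul f g _ _ ihf ihg => exact ihf.mul ihg

theorem exists_homogeneous_near_on_l1_sphere {f : (Fin n → ℝ) → ℝ} (hf : Continuous f) {ε : ℝ}
    (hε : 0 < ε) : ∃ g, LatAlgClosure (coordFun n) g ∧
      (∀ (c : ℝ) (t : Fin n → ℝ), 0 ≤ c → g (c • t) = c * g t) ∧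
      ∀ t, l1 t = 1 → |f t - g t| < ε := by
  let S : Set (Fin n → ℝ) := {t | l1 t = 1}
  have : CompactSpace S := isCompact_iff_compactSpace.mp isCompact_l1_eq_one
  let L : Set C(S, ℝ) := {q | ∃ g, LatAlgClosure (coordFun n) g ∧
      (∀ (c : ℝ) (t : Fin n → ℝ), 0 ≤ c → g (c • t) = c * g t) ∧ ∀ t : S, q t = g t}
  have hL : closure L = ⊤ := by
    refine ContinuousMap.sublattice_closure_eq_top L ⟨0, 0, .zero, by simp, by simp⟩ ?_ ?_ ?_
    · rintro p ⟨g, hg, hgh, hpg⟩ q ⟨h, hh, hhh, hqh⟩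
      refine ⟨g ⊓ h, hg.inf hh, fun c t hc => ?_, fun t => by simp [hpg, hqh]⟩
      simp only [Pi.inf_apply, hgh c t hc, hhh c t hc]
      exact (mul_min_of_nonneg _ _ hc).symm
    · rintro p ⟨g, hg, hgh, hpg⟩ q ⟨h, hh, hhh, hqh⟩
      refine ⟨g ⊔ h, .sup _ _ hg hh, fun c t hc => ?_, fun t => by simp [hpg, hqh]⟩
      simp only [Pi.sup_apply, hgh c t hc, hhh c t hc]
      exact (mul_max_of_nonneg _ _ hc).symm
    · have hmem : ∀ (α β : ℝ) (i : Fin n), ∃ q ∈ L, ∀ t : S, q t = α * (t : Fin n → ℝ) i + β := by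
        intro α β i
        refine ⟨⟨fun t => α * (t : Fin n → ℝ) i + β, (continuous_const.mul
            ((continuous_apply i).comp continuous_subtype_val)).add continuous_const⟩,
          ⟨α • (fun t => t i) + β • l1, .add _ _ (.smul _ _ (.basic _ ⟨i, rfl⟩))
            (.smul _ _ latAlgClosure_l1), fun c t hc => ?_, fun t => ?_⟩, fun t => rfl⟩
        · simp [l1_smul, abs_of_nonneg hc]
          ring
        · have : l1 (t : Fin n → ℝ) = 1 := t.2
          simp [this]
      intro v x y
      have hne : ∃ i : Fin n, True := by
        by_contra! h
        have h1 : l1 (x : Fin n → ℝ) = 1 := x.2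
        rw [l1, Finset.sum_eq_zero fun i _ => (h i).elim] at h1
        exact zero_ne_one h1
      by_cases hxy : x = y
      · obtain ⟨i, -⟩ := hne
        obtain ⟨q, hq, hqt⟩ := hmem 0 (v x) i
        exact ⟨q, hq, by simp [hqt], by simp [hqt, hxy]⟩
      · obtain ⟨i, hi⟩ : ∃ i, (x : Fin n → ℝ) i ≠ (y : Fin n → ℝ) i := by
          by_contra! h
          exact hxy (Subtype.ext (funext h))
        have hi' := sub_ne_zero.mpr hi
        obtain ⟨q, hq, hqt⟩ := hmem ((v x - v y) / ((x : Fin n → ℝ) i - (y : Fin n → ℝ) i))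
          (v x - (v x - v y) / ((x : Fin n → ℝ) i - (y : Fin n → ℝ) i) * (x : Fin n → ℝ) i) i
        refine ⟨q, hq, by simp [hqt], ?_⟩
        rw [hqt]
        field_simp
        ring
  have hmem : (⟨fun t : S => f t, by fun_prop⟩ : C(S, ℝ)) ∈ closure L := hL ▸ trivial
  obtain ⟨q, ⟨g, hg, hgh, hqg⟩, hdist⟩ := Metric.mem_closure_iff.mp hmem ε hε
  refine ⟨g, hg, hgh, fun t ht => ?_⟩
  have h := (ContinuousMap.dist_apply_le_dist (⟨t, ht⟩ : S)).trans_lt hdist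
  rwa [Real.dist_eq, hqg] at h

theorem exists_latAlgClosure_near_zero {f : (Fin n → ℝ) → ℝ} (hf : PolyGrowthH n f) {ε : ℝ}
    (hε : 0 < ε) : ∃ g, LatAlgClosure (coordFun n) g ∧ (∃ C, 0 ≤ C ∧ ∀ t, |g t| ≤ C * l1 t) ∧
      ∃ δ, 0 < δ ∧ ∀ t, l1 t < δ → |f t - g t| ≤ ε * l1 t := by
  obtain ⟨⟨hfc, -⟩, fh, hfh⟩ := hf
  obtain ⟨δ, hδ, hlim⟩ := hfh _ isCompact_l1_eq_one.isBounded (ε / 3) (by positivity)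
  have hf0 : f 0 = 0 := by
    by_contra hne
    obtain ⟨d, hd, h⟩ := hfh {0} Bornology.isBounded_singleton 1 one_pos
    have key : ∀ t : ℝ, 0 < t → t < d → |f 0| < t * (1 + |fh 0|) := by
      intro t ht htd
      have h1 := h t ht htd 0 rfl
      rw [smul_zero] at h1
      have h2 : |f 0 / t| < 1 + |fh 0| := by
        have := abs_sub_abs_le_abs_sub (f 0 / t) (fh 0)
        linarith
      rw [abs_div, abs_of_pos ht, div_lt_iff₀ ht] at h2
      linarith
    have hpos := abs_pos.mpr hne
    have hB : 0 < 1 + |fh 0| := by positivity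
    have h1 := key (min (d / 2) (|f 0| / (1 + |fh 0|))) (by positivity)
      ((min_le_left _ _).trans_lt (by linarith))
    have h2 := mul_le_mul_of_nonneg_right (min_le_right (d / 2) (|f 0| / (1 + |fh 0|))) hB.le
    rw [div_mul_cancel₀ _ hB.ne'] at h2
    linarith
  have hδ2 : 0 < δ / 2 := half_pos hδ
  obtain ⟨g, hg, hgh, hfg⟩ := exists_homogeneous_near_on_l1_sphere
    (f := fun y => f ((δ / 2) • y) / (δ / 2)) (by fun_prop) (ε := ε / 3) (by positivity)
  have hg0 : g 0 = 0 := by simpa using hgh 0 0 le_rfl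
  have hpolar : ∀ t : Fin n → ℝ, t ≠ 0 → 0 < l1 t ∧ l1 ((l1 t)⁻¹ • t) = 1 := by
    intro t ht
    have hpos : 0 < l1 t := (l1_nonneg t).lt_of_ne' fun h => ht (eq_zero_of_l1_eq_zero h)
    refine ⟨hpos, ?_⟩
    rw [l1_smul, abs_of_pos (inv_pos.mpr hpos), inv_mul_cancel₀ hpos.ne']
  refine ⟨g, hg, ?_, δ, hδ, ?_⟩
  · obtain ⟨C, hC⟩ := isCompact_l1_eq_one.exists_bound_of_continuousOn hg.continuous.continuousOn
    refine ⟨|C|, abs_nonneg C, fun t => ?_⟩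
    by_cases ht : t = 0
    · simp [ht, hg0, l1]
    obtain ⟨hpos, hone⟩ := hpolar t ht
    have h1 := (hC _ hone).trans (le_abs_self C)
    rw [hgh _ _ (inv_pos.mpr hpos).le, Real.norm_eq_abs, abs_mul, abs_of_pos (inv_pos.mpr hpos),
      inv_mul_le_iff₀ hpos] at h1
    linarith
  · intro t htδ
    by_cases ht : t = 0
    · simp [ht, hf0, hg0, l1]
    obtain ⟨hpos, hone⟩ := hpolar t ht
    have h1 := hlim _ hpos htδ _ hone
    have h2 := hlim (δ / 2) hδ2 (by linarith) _ hone
    have h3 := hfg _ hone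
    rw [smul_inv_smul₀ hpos.ne'] at h1
    rw [hgh _ _ (inv_pos.mpr hpos).le] at h3
    have h4 : |f t / l1 t - (l1 t)⁻¹ * g t| ≤ ε := by
      rw [abs_lt] at h1 h2 h3
      rw [abs_le]
      constructor <;> linarith
    have h5 : f t / l1 t - (l1 t)⁻¹ * g t = (f t - g t) / l1 t := by
      field_simp
    rwa [h5, abs_div, abs_of_pos hpos, div_le_iff₀ hpos] at h4

theorem exists_multiplier_near {φ : (Fin n → ℝ) → ℝ} (hφ : Continuous φ) (R : ℝ) {ε : ℝ}
    (hε : 0 < ε) : ∃ q : (Fin n → ℝ) → ℝ,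
      (∀ h, LatAlgClosure (coordFun n) h → LatAlgClosure (coordFun n) (q * h)) ∧
      ∀ t, l1 t ≤ R → |q t - φ t| < ε := by
  let K : Set (Fin n → ℝ) := {t | l1 t ≤ R}
  have : CompactSpace K := isCompact_iff_compactSpace.mp (isCompact_l1_le R)
  let A : Subalgebra ℝ C(K, ℝ) :=
    { carrier := {p | ∃ q : (Fin n → ℝ) → ℝ,
        (∀ h, LatAlgClosure (coordFun n) h → LatAlgClosure (coordFun n) (q * h)) ∧
        ∀ t : K, p t = q t}
      mul_mem' := by
        rintro a b ⟨p, hp, hap⟩ ⟨q, hq, hbq⟩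
        refine ⟨p * q, fun h hh => ?_, fun t => by simp [hap, hbq]⟩
        rw [mul_assoc]
        exact hp _ (hq _ hh)
      add_mem' := by
        rintro a b ⟨p, hp, hap⟩ ⟨q, hq, hbq⟩
        refine ⟨p + q, fun h hh => ?_, fun t => by simp [hap, hbq]⟩
        rw [add_mul]
        exact .add _ _ (hp _ hh) (hq _ hh)
      algebraMap_mem' := fun c => ⟨fun _ => c, fun h hh => .smul c _ hh, fun t => rfl⟩ }
  have hsep : A.SeparatesPoints := by
    intro x y hxy
    obtain ⟨i, hi⟩ : ∃ i, (x : Fin n → ℝ) i ≠ (y : Fin n → ℝ) i := by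
      by_contra! h
      exact hxy (Subtype.ext (funext h))
    exact ⟨_, ⟨⟨fun t : K => (t : Fin n → ℝ) i,
        (continuous_apply i).comp continuous_subtype_val⟩,
      ⟨fun t => t i, fun h hh => .mul _ _ (.basic _ ⟨i, rfl⟩) hh, fun t => rfl⟩, rfl⟩, hi⟩
  obtain ⟨⟨p, q, hq, hpq⟩, hp⟩ :=
    ContinuousMap.exists_mem_subalgebra_near_continuous_of_separatesPoints A hsep
      (fun t : K => φ t) (by fun_prop) ε hε
  refine ⟨q, hq, fun t ht => ?_⟩
  have h := hp ⟨t, ht⟩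
  rwa [Real.norm_eq_abs, hpq] at h

theorem exists_latAlgClosure_near {f : (Fin n → ℝ) → ℝ} (hf : Continuous f) {M : ℝ} (hM : 0 ≤ M)
    {N : ℕ} (hfM : ∀ t, |f t| ≤ M * (1 + l1 t) ^ N) {ε δ : ℝ} (hε : 0 < ε) (hδ : 0 < δ)
    (hfδ : ∀ t, l1 t < δ → |f t| ≤ ε * l1 t) :
    ∃ g, LatAlgClosure (coordFun n) g ∧
      ∀ t, |f t - g t| ≤ 2 * ε * (l1 t + l1 t ^ (N + 2)) := by
  set F : (Fin n → ℝ) → ℝ := fun t => l1 t + l1 t ^ (N + 2) with hF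
  have hFc : Continuous F := continuous_l1.add (continuous_l1.pow _)
  have hF0 : ∀ t, 0 ≤ ε * F t := fun t =>
    mul_nonneg hε.le (add_nonneg (l1_nonneg t) (pow_nonneg (l1_nonneg t) _))
  have hFl : ∀ t, ε * l1 t ≤ ε * F t := fun t =>
    mul_le_mul_of_nonneg_left (le_add_of_nonneg_right (pow_nonneg (l1_nonneg t) _)) hε.le
  have hpow : ∀ (B : ℝ) (k : ℕ) (t : Fin n → ℝ), max 1 (B / ε) ≤ l1 t →
      B * l1 t ^ k ≤ ε * l1 t ^ (k + 1) := by
    intro B k t ht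
    have h1 : B ≤ ε * l1 t := by
      have := (le_max_right _ _).trans ht
      rwa [div_le_iff₀' hε] at this
    calc B * l1 t ^ k ≤ ε * l1 t * l1 t ^ k :=
          mul_le_mul_of_nonneg_right h1 (pow_nonneg (l1_nonneg t) _)
      _ = ε * l1 t ^ (k + 1) := by ring
  have hmono : ∀ (k l : ℕ) (t : Fin n → ℝ), 1 ≤ l1 t → k ≤ l → l1 t ^ k ≤ l1 t ^ l :=
    fun k l t ht hkl => pow_le_pow_right₀ ht hkl
  set R₀ : ℝ := max 1 (M * 2 ^ N / ε) with hR₀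
  have hfar : ∀ t, R₀ ≤ l1 t → |f t| ≤ ε * F t := by
    intro t ht
    have h1 : 1 ≤ l1 t := (le_max_left _ _).trans ht
    calc |f t| ≤ M * (1 + l1 t) ^ N := hfM t
      _ ≤ M * (2 * l1 t) ^ N := by
        refine mul_le_mul_of_nonneg_left (pow_le_pow_left₀ ?_ ?_ N) hM <;> linarith
      _ = M * 2 ^ N * l1 t ^ N := by rw [mul_pow]; ring
      _ ≤ ε * l1 t ^ (N + 1) := hpow _ _ _ ht
      _ ≤ ε * l1 t ^ (N + 2) := mul_le_mul_of_nonneg_left (hmono _ _ t h1 (by omega)) hε.le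
      _ ≤ ε * F t := mul_le_mul_of_nonneg_left (le_add_of_nonneg_left (l1_nonneg t)) hε.le
  set f₁ : (Fin n → ℝ) → ℝ := fun t => f t - max (-(ε * F t)) (min (f t) (ε * F t)) with hf₁
  have hf₁c : Continuous f₁ := by fun_prop
  have hf₁0 : ∀ t, |f t| ≤ ε * F t → f₁ t = 0 := by
    intro t ht
    rw [abs_le] at ht
    simp only [hf₁]
    rw [min_eq_left ht.2, max_eq_right ht.1, sub_self]
  have hff₁ : ∀ t, |f t - f₁ t| ≤ ε * F t := by
    intro t
    simp only [hf₁, sub_sub_cancel]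
    exact abs_le.mpr ⟨le_max_left _ _, max_le (by linarith [hF0 t]) (min_le_right _ _)⟩
  set φ : (Fin n → ℝ) → ℝ := fun t => f₁ t / max (l1 t) δ with hφ
  have hmax : ∀ t : Fin n → ℝ, 0 < max (l1 t) δ := fun t => lt_max_of_lt_right hδ
  have hφc : Continuous φ :=
    hf₁c.div (continuous_l1.max continuous_const) fun t => (hmax t).ne'
  have hf₁φ : ∀ t, f₁ t = φ t * l1 t := by
    intro t
    simp only [hφ]
    rcases lt_or_ge (l1 t) δ with ht | ht
    · rw [hf₁0 t ((hfδ t ht).trans (hFl t))]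
      simp
    · rw [max_eq_left ht, div_mul_cancel₀ _ (hδ.trans_le ht).ne']
  obtain ⟨C₀, hC₀⟩ := (isCompact_l1_le (n := n) R₀).exists_bound_of_continuousOn hφc.continuousOn
  set C : ℝ := |C₀| with hC
  have hC0 : 0 ≤ C := abs_nonneg C₀
  have hφC : ∀ t, |φ t| ≤ C := by
    intro t
    rcases le_total (l1 t) R₀ with ht | ht
    · exact (hC₀ t ht).trans (le_abs_self _)
    · simp only [hφ, hf₁0 t (hfar t ht), zero_div, abs_zero]
      exact hC0
  obtain ⟨q, hq, hqφ⟩ := exists_multiplier_near hφc (max R₀ (max 1 (C / ε))) hε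
  have hCl := LatAlgClosure.smul C _ (latAlgClosure_l1 (n := n))
  refine ⟨((q * l1) ⊓ (C • l1)) ⊔ -(C • l1),
    .sup _ _ ((hq _ latAlgClosure_l1).inf hCl) hCl.neg, fun t => ?_⟩
  have hl := l1_nonneg t
  have hCl0 : 0 ≤ C * l1 t := mul_nonneg hC0 hl
  set g : ℝ := max (min (q t * l1 t) (C * l1 t)) (-(C * l1 t)) with hg
  have hgoal : |f₁ t - g| ≤ ε * F t := by
    rcases le_total (l1 t) (max R₀ (max 1 (C / ε))) with ht | ht
    · have h1 : |f₁ t - q t * l1 t| ≤ ε * l1 t := by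
        rw [hf₁φ t, ← sub_mul, abs_mul, abs_of_nonneg hl, abs_sub_comm]
        exact mul_le_mul_of_nonneg_right (hqφ t ht).le hl
      have h2 : |f₁ t| ≤ C * l1 t := by
        rw [hf₁φ t, abs_mul, abs_of_nonneg hl]
        exact mul_le_mul_of_nonneg_right (hφC t) hl
      refine le_trans ?_ (hFl t)
      rw [abs_le] at h1 h2 ⊢
      have hεl := mul_nonneg hε.le hl
      constructor
      · have : g ≤ f₁ t + ε * l1 t := max_le ((min_le_left _ _).trans (by linarith)) (by linarith)
        linarith
      · have : f₁ t - ε * l1 t ≤ g := le_max_of_le_left (le_min (by linarith) (by linarith))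
        linarith
    · have h1 : f₁ t = 0 := hf₁0 t (hfar t ((le_max_left _ _).trans ht))
      have ht' : max 1 (C / ε) ≤ l1 t := (le_max_right _ _).trans ht
      have h2 : |g| ≤ C * l1 t :=
        abs_le.mpr ⟨le_max_right _ _, max_le (min_le_right _ _) (by linarith)⟩
      rw [h1, zero_sub, abs_neg]
      refine h2.trans ?_
      have h3 := hpow C 1 t ht'
      have h4 := hmono 2 (N + 2) t ((le_max_left _ _).trans ht') (by omega)
      rw [pow_one] at h3
      calc C * l1 t ≤ ε * l1 t ^ (N + 2) := h3.trans (mul_le_mul_of_nonneg_left h4 hε.le)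
        _ ≤ ε * F t := mul_le_mul_of_nonneg_left (le_add_of_nonneg_left hl) hε.le
  change |f t - g| ≤ 2 * ε * F t
  calc |f t - g| = |(f t - f₁ t) + (f₁ t - g)| := by rw [sub_add_sub_cancel]
    _ ≤ ε * F t + ε * F t := (abs_add_le _ _).trans (add_le_add (hff₁ t) hgoal)
    _ = 2 * ε * F t := by ring

theorem PolyGrowthH.ruClosure {f : (Fin n → ℝ) → ℝ} (hf : PolyGrowthH n f) :
    RUClosure (coordFun n) f := by
  obtain ⟨hfc, M, N, hM, hfM⟩ := hf.1
  refine ⟨fun t => l1 t + l1 t ^ (N + 3), .add _ _ latAlgClosure_l1 (latAlgClosure_l1_pow _),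
    fun t => add_nonneg (l1_nonneg t) (pow_nonneg (l1_nonneg t) _), fun ε hε => ?_⟩
  obtain ⟨g, hg, ⟨C, hC, hgC⟩, δ, hδ, hfg⟩ := exists_latAlgClosure_near_zero hf (half_pos hε)
  have hfgM : ∀ t, |f t - g t| ≤ (M + C) * (1 + l1 t) ^ (N + 1) := by
    intro t
    have hl := l1_nonneg t
    have h1 : (1 : ℝ) ≤ 1 + l1 t := by linarith
    have h2 : M * (1 + l1 t) ^ N ≤ M * (1 + l1 t) ^ (N + 1) :=
      mul_le_mul_of_nonneg_left (pow_le_pow_right₀ h1 (by omega)) hM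
    have h3 : C * l1 t ≤ C * (1 + l1 t) ^ (N + 1) := by
      refine mul_le_mul_of_nonneg_left ?_ hC
      exact (le_add_of_nonneg_left zero_le_one).trans (le_self_pow₀ h1 (by omega))
    calc |f t - g t| ≤ |f t| + |g t| := abs_sub _ _
      _ ≤ (M + C) * (1 + l1 t) ^ (N + 1) := by
        rw [add_mul]
        exact add_le_add ((hfM t).trans h2) ((hgC t).trans h3)
  obtain ⟨h, hh, hfh⟩ := exists_latAlgClosure_near (hfc.sub hg.continuous) (add_nonneg hM hC)
    hfgM (half_pos hε) hδ hfg
  refine ⟨g + h, .add _ _ hg hh, fun t => ?_⟩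
  have := hfh t
  rw [mul_div_cancel₀ _ two_ne_zero] at this
  change |f t - (g t + h t)| ≤ ε * (l1 t + l1 t ^ (N + 3))
  rw [← sub_sub]
  exact this

end Density

section Closure

variable {n : ℕ} {f g : (Fin n → ℝ) → ℝ}

theorem polyGrowth_of_abs_le_add (hc : Continuous g) {f₁ f₂ : (Fin n → ℝ) → ℝ}
    (hf₁ : PolyGrowth n f₁) (hf₂ : PolyGrowth n f₂) (h : ∀ t, |g t| ≤ |f₁ t| + |f₂ t|) :
    PolyGrowth n g := by
  obtain ⟨-, M₁, N₁, hM₁, h₁⟩ := hf₁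
  obtain ⟨-, M₂, N₂, hM₂, h₂⟩ := hf₂
  refine ⟨hc, M₁ + M₂, N₁ + N₂, add_nonneg hM₁ hM₂, fun t => ?_⟩
  have hl : (1 : ℝ) ≤ 1 + ∑ i, |t i| :=
    le_add_of_nonneg_right (Finset.sum_nonneg fun i _ => abs_nonneg (t i))
  rw [add_mul]
  refine (h t).trans (add_le_add ((h₁ t).trans ?_) ((h₂ t).trans ?_))
  · exact mul_le_mul_of_nonneg_left (pow_le_pow_right₀ hl (by omega)) hM₁
  · exact mul_le_mul_of_nonneg_left (pow_le_pow_right₀ hl (by omega)) hM₂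

namespace PolyGrowth

theorem add (hf : PolyGrowth n f) (hg : PolyGrowth n g) : PolyGrowth n (f + g) :=
  polyGrowth_of_abs_le_add (hf.1.add hg.1) hf hg fun t => abs_add_le (f t) (g t)

theorem sup (hf : PolyGrowth n f) (hg : PolyGrowth n g) : PolyGrowth n (f ⊔ g) :=
  polyGrowth_of_abs_le_add (hf.1.sup hg.1) hf hg fun t =>
    (abs_max_le_max_abs_abs).trans (max_le_add_of_nonneg (abs_nonneg _) (abs_nonneg _))

theorem mul (hf : PolyGrowth n f) (hg : PolyGrowth n g) : PolyGrowth n (f * g) := by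
  obtain ⟨hfc, M₁, N₁, hM₁, h₁⟩ := hf
  obtain ⟨hgc, M₂, N₂, hM₂, h₂⟩ := hg
  refine ⟨hfc.mul hgc, M₁ * M₂, N₁ + N₂, mul_nonneg hM₁ hM₂, fun t => ?_⟩
  rw [Pi.mul_apply, abs_mul, pow_add, mul_mul_mul_comm]
  exact mul_le_mul (h₁ t) (h₂ t) (abs_nonneg _) ((abs_nonneg _).trans (h₁ t))

theorem const (c : ℝ) : PolyGrowth n fun _ => c :=
  ⟨continuous_const, |c|, 0, abs_nonneg c, fun _ => by simp⟩

theorem smul (hf : PolyGrowth n f) (c : ℝ) : PolyGrowth n (c • f) := (const c).mul hf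

theorem coord (i : Fin n) : PolyGrowth n fun t => t i :=
  ⟨continuous_apply i, 1, 1, zero_le_one, fun t => by
    have := abs_apply_le_l1 t i
    rw [l1] at this
    linarith⟩

end PolyGrowth

theorem PolyGrowthH.exists_abs_le_near_zero (hf : PolyGrowthH n f) :
    ∃ C, 0 ≤ C ∧ ∃ δ, 0 < δ ∧ ∀ t, l1 t < δ → |f t| ≤ C * l1 t := by
  obtain ⟨g, -, ⟨C, hC, hgC⟩, δ, hδ, hfg⟩ := exists_latAlgClosure_near_zero hf one_pos
  refine ⟨C + 1, by positivity, δ, hδ, fun t ht => ?_⟩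
  have h := abs_add_le (f t - g t) (g t)
  rw [sub_add_cancel] at h
  linarith [hfg t ht, hgC t]

theorem exists_l1_le_of_isBounded {B : Set (Fin n → ℝ)} (hB : Bornology.IsBounded B) :
    ∃ R, 0 < R ∧ ∀ y ∈ B, l1 y ≤ R := by
  obtain ⟨R, hR⟩ := hB.isCompact_closure.exists_bound_of_continuousOn
    (continuous_l1 (n := n)).continuousOn
  refine ⟨|R| + 1, by positivity, fun y hy => ?_⟩
  have := hR y (subset_closure hy)
  linarith [le_abs_self (l1 y), le_abs_self R, Real.norm_eq_abs (l1 y)]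

namespace PolyGrowthH

theorem add (hf : PolyGrowthH n f) (hg : PolyGrowthH n g) : PolyGrowthH n (f + g) := by
  obtain ⟨hf, fh, hfh⟩ := hf
  obtain ⟨hg, gh, hgh⟩ := hg
  refine ⟨hf.add hg, fh + gh, fun B hB ε hε => ?_⟩
  obtain ⟨δ₁, hδ₁, h₁⟩ := hfh B hB (ε / 2) (half_pos hε)
  obtain ⟨δ₂, hδ₂, h₂⟩ := hgh B hB (ε / 2) (half_pos hε)
  refine ⟨min δ₁ δ₂, lt_min hδ₁ hδ₂, fun t ht htδ y hy => ?_⟩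
  have := h₁ t ht (htδ.trans_le (min_le_left _ _)) y hy
  have := h₂ t ht (htδ.trans_le (min_le_right _ _)) y hy
  rw [Pi.add_apply, Pi.add_apply, add_div, add_sub_add_comm]
  refine (abs_add_le _ _).trans_lt ?_
  linarith

theorem smul (hf : PolyGrowthH n f) (c : ℝ) : PolyGrowthH n (c • f) := by
  obtain ⟨hf, fh, hfh⟩ := hf
  refine ⟨hf.smul c, c • fh, fun B hB ε hε => ?_⟩
  have hc : 0 < |c| + 1 := by positivity
  obtain ⟨δ, hδ, h⟩ := hfh B hB (ε / (|c| + 1)) (div_pos hε hc)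
  refine ⟨δ, hδ, fun t ht htδ y hy => ?_⟩
  have h1 := h t ht htδ y hy
  rw [lt_div_iff₀ hc] at h1
  rw [Pi.smul_apply, Pi.smul_apply, smul_eq_mul, smul_eq_mul, mul_div_assoc, ← mul_sub, abs_mul]
  have := abs_nonneg (f (t • y) / t - fh y)
  linarith

theorem sup (hf : PolyGrowthH n f) (hg : PolyGrowthH n g) : PolyGrowthH n (f ⊔ g) := by
  obtain ⟨hf, fh, hfh⟩ := hf
  obtain ⟨hg, gh, hgh⟩ := hg
  refine ⟨hf.sup hg, fh ⊔ gh, fun B hB ε hε => ?_⟩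
  obtain ⟨δ₁, hδ₁, h₁⟩ := hfh B hB ε hε
  obtain ⟨δ₂, hδ₂, h₂⟩ := hgh B hB ε hε
  refine ⟨min δ₁ δ₂, lt_min hδ₁ hδ₂, fun t ht htδ y hy => ?_⟩
  change |max (f (t • y)) (g (t • y)) / t - max (fh y) (gh y)| < ε
  rw [← max_div_div_right ht.le]
  exact (abs_max_sub_max_le_max _ _ _ _).trans_lt (max_lt
    (h₁ t ht (htδ.trans_le (min_le_left _ _)) y hy)
    (h₂ t ht (htδ.trans_le (min_le_right _ _)) y hy))

theorem mul (hf : PolyGrowthH n f) (hg : PolyGrowthH n g) : PolyGrowthH n (f * g) := by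
  obtain ⟨C₁, hC₁, δ₁, hδ₁, h₁⟩ := hf.exists_abs_le_near_zero
  obtain ⟨C₂, hC₂, δ₂, hδ₂, h₂⟩ := hg.exists_abs_le_near_zero
  refine ⟨hf.1.mul hg.1, 0, fun B hB ε hε => ?_⟩
  obtain ⟨R, hR, hBR⟩ := exists_l1_le_of_isBounded hB
  have hCR : 0 < C₁ * C₂ * R ^ 2 + 1 := by positivity
  refine ⟨min (min (δ₁ / R) (δ₂ / R)) (ε / (C₁ * C₂ * R ^ 2 + 1)), by positivity,
    fun t ht htδ y hy => ?_⟩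
  simp only [lt_min_iff, lt_div_iff₀ hR, lt_div_iff₀ hCR] at htδ
  obtain ⟨⟨ht₁, ht₂⟩, htε⟩ := htδ
  have hl : l1 (t • y) = t * l1 y := by rw [l1_smul, abs_of_pos ht]
  have hle : t * l1 y ≤ t * R := mul_le_mul_of_nonneg_left (hBR y hy) ht.le
  have hf1 : |f (t • y)| ≤ C₁ * (t * R) :=
    (h₁ _ (by linarith)).trans (mul_le_mul_of_nonneg_left (hl.trans_le hle) hC₁)
  have hg1 : |g (t • y)| ≤ C₂ * (t * R) :=
    (h₂ _ (by linarith)).trans (mul_le_mul_of_nonneg_left (hl.trans_le hle) hC₂)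
  rw [Pi.zero_apply, sub_zero, Pi.mul_apply, abs_div, abs_mul, abs_of_pos ht, div_lt_iff₀ ht]
  calc |f (t • y)| * |g (t • y)| ≤ C₁ * (t * R) * (C₂ * (t * R)) :=
        mul_le_mul hf1 hg1 (abs_nonneg _) (by positivity)
    _ = t * (C₁ * C₂ * R ^ 2) * t := by ring
    _ < ε * t := mul_lt_mul_of_pos_right (by linarith) ht

theorem zero : PolyGrowthH n 0 :=
  ⟨PolyGrowth.const 0, 0, fun _ _ _ hε => ⟨1, one_pos, fun _ _ _ _ _ => by simpa using hε⟩⟩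

theorem coord (i : Fin n) : PolyGrowthH n fun t => t i :=
  ⟨PolyGrowth.coord i, fun y => y i, fun _ _ _ hε =>
    ⟨1, one_pos, fun t ht _ y _ => by simpa [mul_div_cancel_left₀ _ ht.ne'] using hε⟩⟩

theorem neg (hf : PolyGrowthH n f) : PolyGrowthH n (-f) := by simpa using hf.smul (-1)

theorem inf (hf : PolyGrowthH n f) (hg : PolyGrowthH n g) : PolyGrowthH n (f ⊓ g) := by
  simpa [neg_sup] using (hf.neg.sup hg.neg).neg

end PolyGrowthH

theorem isSublatticeAlgebraSet_polyGrowthH : IsSublatticeAlgebraSet {f | PolyGrowthH n f} :=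
  ⟨⟨.zero, fun _ hf _ hg => PolyGrowthH.add hf hg, fun c _ hf => PolyGrowthH.smul hf c,
    fun _ hf => PolyGrowthH.neg hf, fun _ hf _ hg => PolyGrowthH.sup hf hg,
    fun _ hf _ hg => PolyGrowthH.inf hf hg⟩, fun _ hf _ hg => PolyGrowthH.mul hf hg⟩

/-- Multiplying by the absolute value of an extra coordinate maps `PG_n` to `PG_{n+1}^h`. -/
theorem PolyGrowth.polyGrowthH_mul_abs (hf : PolyGrowth n f) :
    PolyGrowthH (n + 1) fun t => f (fun i => t i.succ) * |t 0| := by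
  obtain ⟨hfc, M, N, hM, hfM⟩ := hf
  refine ⟨PolyGrowth.mul (f := fun t : Fin (n + 1) → ℝ => f fun i => t i.succ)
    ⟨by fun_prop, M, N, hM, fun t => ?_⟩
    (polyGrowth_of_abs_le_add (by fun_prop) (PolyGrowth.coord 0) (PolyGrowth.const 0)
      fun t => by simp), fun y => f 0 * |y 0|, fun B hB ε hε => ?_⟩
  · refine (hfM _).trans (mul_le_mul_of_nonneg_left (pow_le_pow_left₀ ?_ ?_ N) hM)
    · exact add_nonneg zero_le_one (Finset.sum_nonneg fun i _ => abs_nonneg _)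
    · rw [Fin.sum_univ_succ]
      linarith [abs_nonneg (t 0)]
  · obtain ⟨R, hR, hBR⟩ := exists_l1_le_of_isBounded hB
    obtain ⟨δ, hδ, hfδ⟩ := Metric.continuousAt_iff.mp hfc.continuousAt (ε / R) (div_pos hε hR)
    refine ⟨δ / R, div_pos hδ hR, fun t ht htδ y hy => ?_⟩
    rw [lt_div_iff₀ hR] at htδ
    have hyR : ‖y‖ ≤ R := (norm_le_l1 y).trans (hBR y hy)
    have h1 := hfδ (x := fun i => t * y i.succ) (by
      rw [dist_zero_right, pi_norm_lt_iff hδ]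
      intro i
      rw [norm_mul, Real.norm_of_nonneg ht.le]
      exact (mul_le_mul_of_nonneg_left ((norm_le_pi_norm y _).trans hyR) ht.le).trans_lt htδ)
    rw [Real.dist_eq, lt_div_iff₀ hR] at h1
    have h2 : f (fun i => t * y i.succ) * (t * |y 0|) / t - f 0 * |y 0|
        = (f (fun i => t * y i.succ) - f 0) * |y 0| := by
      field_simp
    simp only [Pi.smul_apply, smul_eq_mul, abs_mul, abs_of_pos ht]
    rw [h2, abs_mul, abs_abs]
    exact (mul_le_mul_of_nonneg_left ((abs_apply_le_l1 y 0).trans (hBR y hy))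
      (abs_nonneg _)).trans_lt h1

end Closure

section ZeroExtend

variable {X : Type*} [Lattice X] [NonUnitalRing X] [Module ℝ X] {n : ℕ}
  {P : ((Fin n → ℝ) → ℝ) → Prop}

open Classical in
/-- Extension by zero of a map defined on a class of functions. -/
noncomputable def zeroExtend (Ψ : ∀ f, P f → X) (f : (Fin n → ℝ) → ℝ) : X :=
  if h : P f then Ψ f h else 0

theorem zeroExtend_of_mem (Ψ : ∀ f, P f → X) {f : (Fin n → ℝ) → ℝ} (h : P f) :
    zeroExtend Ψ f = Ψ f h := dif_pos h

theorem IsLatAlgHom.isLatAlgHomOn_zeroExtend {Ψ : ∀ f, P f → X} (hΨ : IsLatAlgHom P Ψ)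
    (hP : IsSublatticeAlgebraSet {f | P f}) : IsLatAlgHomOn {f | P f} (zeroExtend Ψ) := by
  obtain ⟨⟨-, hadd, hsmul, -, hsup, -⟩, hmul⟩ := hP
  refine ⟨fun f hf g hg => ?_, fun c f hf => ?_, fun f hf g hg => ?_, fun f hf g hg => ?_⟩
  · rw [zeroExtend_of_mem Ψ hf, zeroExtend_of_mem Ψ hg, zeroExtend_of_mem Ψ (hadd f hf g hg)]
    exact hΨ.1.1 f g hf hg _
  · rw [zeroExtend_of_mem Ψ hf, zeroExtend_of_mem Ψ (hsmul c f hf)]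
    exact hΨ.1.2.1 c f hf _
  · rw [zeroExtend_of_mem Ψ hf, zeroExtend_of_mem Ψ hg, zeroExtend_of_mem Ψ (hsup f hf g hg)]
    exact hΨ.1.2.2 f g hf hg _
  · rw [zeroExtend_of_mem Ψ hf, zeroExtend_of_mem Ψ hg, zeroExtend_of_mem Ψ (hmul f hf g hg)]
    exact hΨ.2 f g hf hg _

end ZeroExtend

namespace IsLatAlgHomOn

variable {Y X : Type*} [Lattice Y] [NonUnitalRing Y] [Module ℝ Y] [Lattice X] [NonUnitalRing X]
  [Module ℝ X] {S : Set Y} {T : Y → X} {a b : Y}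

theorem map_neg (hT : IsLatAlgHomOn S T) (ha : a ∈ S) : T (-a) = -T a := by
  simpa using hT.2.1 (-1) a ha

theorem map_abs (hT : IsLatAlgHomOn S T) (hS : IsSublatticeAlgebraSet S) (ha : a ∈ S) :
    T |a| = |T a| := by
  rw [abs, hT.2.2.1 a ha _ (hS.1.2.2.2.1 a ha), hT.map_neg ha, abs]

theorem map_le (hT : IsLatAlgHomOn S T) (ha : a ∈ S) (hb : b ∈ S) (hab : a ≤ b) : T a ≤ T b := by
  have h := hT.2.2.1 a ha b hb
  rw [sup_eq_right.mpr hab] at h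
  exact sup_eq_right.mp h.symm

theorem map_inf [IsOrderedAddMonoid Y] [IsOrderedAddMonoid X] (hT : IsLatAlgHomOn S T)
    (hS : IsSublatticeAlgebraSet S) (ha : a ∈ S) (hb : b ∈ S) : T (a ⊓ b) = T a ⊓ T b := by
  obtain ⟨⟨-, -, -, hneg, hsup, -⟩, -⟩ := hS
  have h := hT.map_neg (hsup _ (hneg a ha) _ (hneg b hb))
  rw [hT.2.2.1 _ (hneg a ha) _ (hneg b hb), hT.map_neg ha, hT.map_neg hb, ← neg_inf, ← neg_inf,
    neg_neg, neg_neg] at h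
  exact h

end IsLatAlgHomOn

section OrderInstances

variable {X : Type*} [PartialOrder X]

theorem isOrderedAddMonoid_of_addLeftMono [AddCommMonoid X] [AddLeftMono X] :
    IsOrderedAddMonoid X where
  add_le_add_left _ _ h c := by simpa only [add_comm _ c] using add_le_add_right h c

variable [NonUnitalRing X] [IsOrderedAddMonoid X]

theorem posMulMono_of_mul_nonneg (h : ∀ a b : X, 0 ≤ a → 0 ≤ b → 0 ≤ a * b) : PosMulMono X :=
  ⟨fun a ha b c hbc => by
    rw [← sub_nonneg, ← mul_sub]
    exact h _ _ ha (sub_nonneg.mpr hbc)⟩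

theorem mulPosMono_of_mul_nonneg (h : ∀ a b : X, 0 ≤ a → 0 ≤ b → 0 ≤ a * b) : MulPosMono X :=
  ⟨fun a ha b c hbc => by
    rw [← sub_nonneg, ← sub_mul]
    exact h _ _ (sub_nonneg.mpr hbc) ha⟩

end OrderInstances

section Main

variable {X : Type*} [Lattice X]

theorem inf_eq_zero_of_forall_exists_isLatAlgHom [NonUnitalRing X] [Module ℝ X]
    [IsOrderedAddMonoid X] [PosMulMono X]
    (hA : ∀ a b : X, 0 ≤ a → 0 ≤ b → (∀ k : ℕ, k • a ≤ b) → a = 0)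
    (h : ∀ x : Fin 3 → X, ∃ Ψ : ∀ f : (Fin 3 → ℝ) → ℝ, PolyGrowthH 3 f → X,
      IsLatAlgHom (PolyGrowthH 3) Ψ ∧
        ∀ (i : Fin 3) (hi : PolyGrowthH 3 fun t => t i), Ψ (fun t => t i) hi = x i)
    (a b z : X) (hab : a ⊓ b = 0) (hz : 0 ≤ z) : (z * a) ⊓ b = 0 ∧ (a * z) ⊓ b = 0 := by
  have ha : 0 ≤ a := hab ▸ inf_le_left
  have hb : 0 ≤ b := hab ▸ inf_le_right
  obtain ⟨Ψ, hΨ, hx⟩ := h ![a, b, z]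
  have hS := isSublatticeAlgebraSet_polyGrowthH (n := 3)
  have hT := hΨ.isLatAlgHomOn_zeroExtend hS
  have hc : ∀ i, zeroExtend Ψ (fun t => t i) = ![a, b, z] i := fun i =>
    (zeroExtend_of_mem Ψ (.coord i)).trans (hx i _)
  set T := zeroExtend Ψ
  obtain ⟨⟨-, hadd, hsmul, hneg, hsup, hinf⟩, hmul⟩ := id hS
  have hcoord : ∀ i : Fin 3, 0 ≤ ![a, b, z] i → ∃ p, PolyGrowthH 3 p ∧ 0 ≤ p ∧
      T p = ![a, b, z] i := by
    intro i hi
    have hci := PolyGrowthH.coord i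
    refine ⟨|fun t => t i|, hsup _ hci _ (hneg _ hci), abs_nonneg _, ?_⟩
    rw [hT.map_abs hS hci, hc i, abs_of_nonneg hi]
  obtain ⟨p, hp, hp0, hpa⟩ := hcoord 0 ha
  obtain ⟨q, hq, hq0, hqb⟩ := hcoord 1 hb
  obtain ⟨s, hs, hs0, hsz⟩ := hcoord 2 hz
  change T p = a at hpa
  change T q = b at hqb
  change T s = z at hsz
  have hsp := hmul s hs p hp
  have hsps := hmul _ hsp s hs
  have hTsp : T (s * p) = z * a := by rw [hT.2.2.2 s hs p hp, hpa, hsz]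
  have hTpq : T (p ⊓ q) = 0 := by rw [hT.map_inf hS hp hq, hpa, hqb, hab]
  have hcomm : a * z = z * a := by
    rw [← hTsp, mul_comm s p, hT.2.2.2 p hp s hs, hpa, hsz]
  rw [hcomm, and_self]
  have hza := mul_nonneg hz ha
  refine hA _ (z * a * z) (le_inf hza hb) (mul_nonneg hza hz) fun k => ?_
  have hpt : (k : ℝ) • ((s * p) ⊓ q) ≤ ((k : ℝ) ^ 2) • (p ⊓ q) + s * p * s := by
    intro t
    change (k : ℝ) * min (s t * p t) (q t) ≤ (k : ℝ) ^ 2 * min (p t) (q t) + s t * p t * s t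
    have hp0 : 0 ≤ p t := hp0 t
    have hq0 : 0 ≤ q t := hq0 t
    have hs0 : 0 ≤ s t := hs0 t
    have hk0 : (0 : ℝ) ≤ k := Nat.cast_nonneg k
    have hsp0 := mul_nonneg hs0 hp0
    rcases le_total (s t) k with hsk | hsk
    · refine le_trans ?_ (le_add_of_nonneg_right (mul_nonneg hsp0 hs0))
      rw [sq, mul_assoc]
      refine mul_le_mul_of_nonneg_left ?_ hk0
      rcases Nat.eq_zero_or_pos k with rfl | hk
      · have : s t = 0 := le_antisymm (by simpa using hsk) hs0
        simp [this, hq0]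
      · have hk1 : (1 : ℝ) ≤ k := Nat.one_le_cast.mpr hk
        rw [mul_min_of_nonneg _ _ hk0]
        exact min_le_min (mul_le_mul_of_nonneg_right hsk hp0) (le_mul_of_one_le_left hq0 hk1)
    · refine le_trans ?_ (le_add_of_nonneg_left (mul_nonneg (sq_nonneg _) (le_min hp0 hq0)))
      rw [mul_comm (s t * p t)]
      exact mul_le_mul hsk (min_le_left _ _) (le_min hsp0 hq0) hs0
  have hspq := hinf _ hsp q hq
  have hpq := hsmul ((k : ℝ) ^ 2) _ (hinf p hp q hq)
  have hle := hT.map_le (hsmul k _ hspq) (hadd _ hpq _ hsps) hpt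
  rwa [hT.2.1 _ _ hspq, hT.1 _ hpq _ hsps, hT.2.1 _ _ (hinf p hp q hq), hTpq, smul_zero, zero_add,
    hT.map_inf hS hsp hq, hT.2.2.2 _ hsp s hs, hTsp, hqb, hsz, Nat.cast_smul_eq_nsmul] at hle

theorem one_nonneg_of_mul_inf_eq_zero [Ring X] [IsOrderedAddMonoid X] [PosMulMono X]
    (hF : ∀ a b z : X, a ⊓ b = 0 → 0 ≤ z → (z * a) ⊓ b = 0 ∧ (a * z) ⊓ b = 0) :
    (0 : X) ≤ 1 := by
  have hd : (1 : X)⁺ ⊓ (1 : X)⁻ = 0 := posPart_inf_negPart_eq_zero 1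
  have hn := negPart_nonneg (1 : X)
  have h1 := (hF _ _ _ hd hn).1
  rw [inf_comm] at h1
  have h2 := (hF _ _ _ h1 (posPart_nonneg (1 : X))).2
  rw [inf_idem] at h2
  have h3 : (1 : X)⁻ = -((1 : X)⁻ * (1 : X)⁻) :=
    calc (1 : X)⁻ = (1 : X)⁻ * ((1 : X)⁺ - (1 : X)⁻) := by rw [posPart_sub_negPart, mul_one]
      _ = -((1 : X)⁻ * (1 : X)⁻) := by rw [mul_sub, h2, zero_sub]
  refine negPart_eq_zero.mp (le_antisymm ?_ hn)
  rw [h3]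
  exact neg_nonpos.mpr (mul_nonneg hn hn)

theorem exists_isLatAlgHom_polyGrowth [Ring X] [Module ℝ X] {n : ℕ} (h1 : (0 : X) ≤ 1)
    [IsOrderedAddMonoid X]
    (h : ∀ x : Fin (n + 1) → X, ∃ Ψ : ∀ f : (Fin (n + 1) → ℝ) → ℝ, PolyGrowthH (n + 1) f → X,
      IsLatAlgHom (PolyGrowthH (n + 1)) Ψ ∧
        ∀ (i : Fin (n + 1)) (hi : PolyGrowthH (n + 1) fun t => t i), Ψ (fun t => t i) hi = x i)
    (x : Fin n → X) :
    ∃ Ψ : ∀ f : (Fin n → ℝ) → ℝ, PolyGrowth n f → X,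
      IsLatAlgHom (PolyGrowth n) Ψ ∧ (∀ h1 : PolyGrowth n 1, Ψ 1 h1 = 1) ∧
        ∀ (i : Fin n) (hi : PolyGrowth n fun t => t i), Ψ (fun t => t i) hi = x i := by
  obtain ⟨Ψ, hΨ, hx⟩ := h (Fin.cons 1 x)
  have hS := isSublatticeAlgebraSet_polyGrowthH (n := n + 1)
  have hT := hΨ.isLatAlgHomOn_zeroExtend hS
  have hc : ∀ i, zeroExtend Ψ (fun t => t i) = (Fin.cons 1 x : Fin (n + 1) → X) i := fun i =>
    (zeroExtend_of_mem Ψ (.coord i)).trans (hx i _)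
  set T := zeroExtend Ψ
  let F : ((Fin n → ℝ) → ℝ) → (Fin (n + 1) → ℝ) → ℝ := fun f t => f (fun i => t i.succ) * |t 0|
  have hFP : ∀ f, PolyGrowth n f → PolyGrowthH (n + 1) (F f) := fun f hf => hf.polyGrowthH_mul_abs
  have hv : PolyGrowthH (n + 1) |fun t => t 0| :=
    (PolyGrowthH.coord 0).sup (PolyGrowthH.coord 0).neg
  have hTv : T |fun t => t 0| = 1 := by
    rw [hT.map_abs hS (PolyGrowthH.coord 0), hc, Fin.cons_zero, abs_of_nonneg h1]
  refine ⟨fun f _ => T (F f), ⟨⟨?_, ?_, ?_⟩, ?_⟩, fun _ => ?_, fun i _ => ?_⟩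
  · intro f g hf hg _
    rw [← hT.1 _ (hFP f hf) _ (hFP g hg)]
    refine congrArg T (funext fun t => ?_)
    simp [F, add_mul]
  · intro c f hf _
    rw [← hT.2.1 c _ (hFP f hf)]
    refine congrArg T (funext fun t => ?_)
    simp [F, mul_assoc]
  · intro f g hf hg _
    rw [← hT.2.2.1 _ (hFP f hf) _ (hFP g hg)]
    refine congrArg T (funext fun t => ?_)
    exact max_mul_of_nonneg _ _ (abs_nonneg _)
  · intro f g hf hg hfg
    change T (F (f * g)) = _
    rw [← hT.2.2.2 _ (hFP f hf) _ (hFP g hg), ← mul_one (T (F (f * g))), ← hTv,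
      ← hT.2.2.2 _ (hFP _ hfg) _ hv]
    refine congrArg T (funext fun t => ?_)
    simp only [F, Pi.mul_apply, Pi.abs_apply]
    ring
  · rw [← hTv]
    refine congrArg T (funext fun t => ?_)
    simp [F]
  · rw [← mul_one (x i), ← hTv, ← Fin.cons_succ (α := fun _ => X) 1 x i, ← hc,
      ← hT.2.2.2 _ (PolyGrowthH.coord i.succ) _ hv]
    rfl

end Main

/-- Proposition 2.12 / `prop:ucPG`: an Archimedean uniformly complete
lattice-ordered algebra admits a polynomial growth continuous function calculus
(without constants, resp. with constants when it has an identity) iff it is an `f`-algebra. -/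
theorem stmt_7 :
    (∀ (X : Type u) [Lattice X] [NonUnitalRing X] [Module ℝ X],
      ∀ [CovariantClass X X (· + ·) (· ≤ ·)] [IsScalarTower ℝ X X] [SMulCommClass ℝ X X],
      (∀ (c : ℝ) (a : X), 0 ≤ c → 0 ≤ a → 0 ≤ c • a) →
      (∀ a b : X, 0 ≤ a → 0 ≤ b → 0 ≤ a * b) →
      (∀ a b : X, 0 ≤ a → 0 ≤ b → (∀ k : ℕ, k • a ≤ b) → a = 0) →
      UniformlyComplete X →
      ((∀ (n : ℕ) (x : Fin n → X), ∃ Ψ : ∀ f : (Fin n → ℝ) → ℝ, PolyGrowthH n f → X,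
          IsLatAlgHom (PolyGrowthH n) Ψ ∧
          ∀ (i : Fin n) (hi : PolyGrowthH n fun t => t i), Ψ (fun t => t i) hi = x i) ↔
        (∀ a b z : X, a ⊓ b = 0 → 0 ≤ z → (z * a) ⊓ b = 0 ∧ (a * z) ⊓ b = 0))) ∧
    (∀ (X : Type u) [Lattice X] [Ring X] [Module ℝ X],
      ∀ [CovariantClass X X (· + ·) (· ≤ ·)] [IsScalarTower ℝ X X] [SMulCommClass ℝ X X],
      (∀ (c : ℝ) (a : X), 0 ≤ c → 0 ≤ a → 0 ≤ c • a) →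
      (∀ a b : X, 0 ≤ a → 0 ≤ b → 0 ≤ a * b) →
      (∀ a b : X, 0 ≤ a → 0 ≤ b → (∀ k : ℕ, k • a ≤ b) → a = 0) →
      UniformlyComplete X →
      ((∀ (n : ℕ) (x : Fin n → X), ∃ Ψ : ∀ f : (Fin n → ℝ) → ℝ, PolyGrowth n f → X,
          IsLatAlgHom (PolyGrowth n) Ψ ∧ (∀ h1 : PolyGrowth n 1, Ψ 1 h1 = 1) ∧
          ∀ (i : Fin n) (hi : PolyGrowth n fun t => t i), Ψ (fun t => t i) hi = x i) ↔
        (∀ a b z : X, a ⊓ b = 0 → 0 ≤ z → (z * a) ⊓ b = 0 ∧ (a * z) ⊓ b = 0))) := by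
  refine ⟨?_, ?_⟩
  · intro X _ _ _ _ _ _ hsmul hmul hA hU
    have : IsOrderedAddMonoid X := isOrderedAddMonoid_of_addLeftMono
    have : PosSMulMono ℝ X := .of_smul_nonneg fun c hc a ha => hsmul c a hc ha
    have : PosMulMono X := posMulMono_of_mul_nonneg hmul
    have : MulPosMono X := mulPosMono_of_mul_nonneg hmul
    exact ⟨fun h => inf_eq_zero_of_forall_exists_isLatAlgHom hA (h 3), fun hF n x =>
      exists_isLatAlgHom_of_ruClosure hA hF hU (fun _ => PolyGrowthH.ruClosure) x⟩
  · intro X _ _ _ _ _ _ hsmul hmul hA hU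
    have : IsOrderedAddMonoid X := isOrderedAddMonoid_of_addLeftMono
    have : PosSMulMono ℝ X := .of_smul_nonneg fun c hc a ha => hsmul c a hc ha
    have : PosMulMono X := posMulMono_of_mul_nonneg hmul
    have : MulPosMono X := mulPosMono_of_mul_nonneg hmul
    refine ⟨fun h => inf_eq_zero_of_forall_exists_isLatAlgHom hA fun x => ?_, fun hF n x =>
      exists_isLatAlgHom_polyGrowth (one_nonneg_of_mul_inf_eq_zero hF) (fun y =>
        exists_isLatAlgHom_of_ruClosure hA hF hU (fun _ => PolyGrowthH.ruClosure) y) x⟩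
    obtain ⟨Ψ, ⟨⟨hadd, hsm, hsup⟩, hmu⟩, -, hx⟩ := h 3 x
    exact ⟨fun f hf => Ψ f hf.1, ⟨⟨fun f g hf hg hfg => hadd f g hf.1 hg.1 hfg.1,
      fun c f hf hcf => hsm c f hf.1 hcf.1, fun f g hf hg hfg => hsup f g hf.1 hg.1 hfg.1⟩,
      fun f g hf hg hfg => hmu f g hf.1 hg.1 hfg.1⟩, fun i hi => hx i hi.1⟩
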